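/- arXiv:2002.08644 — 3 statements merged into one kernel-verified Lean document; each statement's English description precedes it below -/
import Mathlib

section
/- Let D be a circle domain and let φ : D → Ω be a conformal homeomorphism of D onto a bounded domain Ω ⊆ ℂ such that the connected components of ∂Ω containing more than one point form a countable family {P_n} and the union of the singleton connected components of ∂Ω has σ-finite linear measure. Fix n, let Q_n be a connected component of ∂D with φ^B(Q_n) = P_n, and suppose there exists an open set U_n ⊆ ℂ with P_n ⊆ U_n and Σ_{k : P_k ⊆ U_n} diam(P_k) < ∞. Then liminf_{r→0⁺} σ_r(z₀) = 0 for every z₀ ∈ Q_n. -/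
open Set Metric Filter MeasureTheory Topology

noncomputable section

/-- A planar domain: a nonempty open connected subset of ℂ. -/
def IsPlanarDomain (D : Set ℂ) : Prop := D.Nonempty ∧ IsOpen D ∧ IsConnected D

/-- A Peano compactum: a compact subset of ℂ all of whose connected components are
locally connected (as subspaces of ℂ) and such that for every `C > 0` only finitely
many components have diameter greater than `C`. -/
def IsPeanoCompactum (K : Set ℂ) : Prop :=
  IsCompact K ∧
  (∀ x ∈ K, LocallyConnectedSpace ↥(connectedComponentIn K x)) ∧
  ∀ C : ℝ, 0 < C →
    {Q : Set ℂ | (∃ x ∈ K, Q = connectedComponentIn K x) ∧ C < Metric.diam Q}.Finite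

/-- A Jordan curve: a subset of ℂ homeomorphic to the unit circle. -/
def IsJordanCurve (J : Set ℂ) : Prop :=
  Nonempty (↥J ≃ₜ ↥(Metric.sphere (0:ℂ) 1))

/-- A generalized Jordan domain: a bounded domain whose boundary is a Peano compactum,
each of whose boundary components is a single point or a Jordan curve. -/
def IsGeneralizedJordanDomain (D : Set ℂ) : Prop :=
  IsPlanarDomain D ∧ Bornology.IsBounded D ∧
  IsPeanoCompactum (frontier D) ∧
  ∀ x ∈ frontier D,
    connectedComponentIn (frontier D) x = {x} ∨
    IsJordanCurve (connectedComponentIn (frontier D) x)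

/-- `φ` restricts to a homeomorphism of `D` onto `Ω`. -/
def IsHomeoOnto (φ : ℂ → ℂ) (D Ω : Set ℂ) : Prop :=
  ContinuousOn φ D ∧ Set.BijOn φ D Ω ∧
  ∃ ψ : ℂ → ℂ, ContinuousOn ψ Ω ∧ Set.InvOn ψ φ D Ω

/-- `φ` is a conformal homeomorphism (holomorphic bijection) of `D` onto `Ω`. -/
def IsConformalHomeoOnto (φ : ℂ → ℂ) (D Ω : Set ℂ) : Prop :=
  DifferentiableOn ℂ φ D ∧ Set.BijOn φ D Ω

/-- `φb` is a continuous extension of `φ : D → Ω` to `closure D`, with values in `closure Ω`. -/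
def ExtendsContinuously (φ φb : ℂ → ℂ) (D Ω : Set ℂ) : Prop :=
  ContinuousOn φb (closure D) ∧ Set.EqOn φb φ D ∧ Set.MapsTo φb (closure D) (closure Ω)

/-- The oscDiam `σ_r(z₀) = diam φ(D ∩ C_r(z₀))`. -/
def oscDiam (φ : ℂ → ℂ) (D : Set ℂ) (z₀ : ℂ) (r : ℝ) : ℝ :=
  Metric.diam (φ '' (D ∩ Metric.sphere z₀ r))

/-- `liminf_{r→0⁺} σ_r(z₀) = 0`. -/
def OscLiminfZero (φ : ℂ → ℂ) (D : Set ℂ) (z₀ : ℂ) : Prop :=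
  Filter.liminf (oscDiam φ D z₀) (nhdsWithin (0:ℝ) (Set.Ioi 0)) = 0

/-- A circle domain (normalized so that ∞ lies in a complementary disk): every bounded
complementary component is a point or a closed round disk, and the unbounded
complementary component is the complement of an open round disk. -/
def IsCircleDomain (D : Set ℂ) : Prop :=
  IsPlanarDomain D ∧ Bornology.IsBounded D ∧
  ∀ x ∈ Dᶜ,
    (Bornology.IsBounded (connectedComponentIn Dᶜ x) →
      connectedComponentIn Dᶜ x = {x} ∨
      ∃ c : ℂ, ∃ rad : ℝ, 0 < rad ∧ connectedComponentIn Dᶜ x = Metric.closedBall c rad) ∧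
    (¬ Bornology.IsBounded (connectedComponentIn Dᶜ x) →
      ∃ c : ℂ, ∃ rad : ℝ, 0 < rad ∧ connectedComponentIn Dᶜ x = (Metric.ball c rad)ᶜ)

/-- A set has σ-finite linear (1-dimensional Hausdorff) measure. -/
def SigmaFiniteH1 (E : Set ℂ) : Prop :=
  ∃ f : ℕ → Set ℂ, (⋃ n, f n) = E ∧ ∀ n, μH[1] (f n) < ⊤

/-- The set of connected components of `K` containing more than one point. -/
def NondegComponents (K : Set ℂ) : Set (Set ℂ) :=
  {Q | (∃ x ∈ K, Q = connectedComponentIn K x) ∧ ∃ a ∈ Q, ∃ b ∈ Q, a ≠ b}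

/-- The union of the singleton connected components of `K`. -/
def SingletonPart (K : Set ℂ) : Set ℂ :=
  {x | x ∈ K ∧ connectedComponentIn K x = {x}}

/-- The cluster set `C(h, z₀) = ⋂_{r>0} closure h({z ∈ U : |z − z₀| < r})`. -/
def clusterSet (h : ℂ → ℂ) (U : Set ℂ) (z₀ : ℂ) : Set ℂ :=
  ⋂ r ∈ Set.Ioi (0:ℝ), closure (h '' (U ∩ Metric.ball z₀ r))

/-- The boundary component of `Ω` corresponding (under `φ : D → Ω`) to a boundary
component `Q` of `D`: `φ^B(Q) = ⋃_{z ∈ Q} C(φ, z)`. -/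
def boundaryComp (φ : ℂ → ℂ) (D : Set ℂ) (Q : Set ℂ) : Set ℂ :=
  ⋃ z ∈ Q, clusterSet φ D z

/-- An arc: the image of a continuous injective map from `[0,1]`. -/
def IsArc (A : Set ℂ) : Prop :=
  ∃ f : ℝ → ℂ, ContinuousOn f (Set.Icc 0 1) ∧ Set.InjOn f (Set.Icc 0 1) ∧
    f '' Set.Icc 0 1 = A

/-- An arc from `a` to `b`. -/
def IsArcFromTo (A : Set ℂ) (a b : ℂ) : Prop :=
  ∃ f : ℝ → ℂ, ContinuousOn f (Set.Icc 0 1) ∧ Set.InjOn f (Set.Icc 0 1) ∧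
    f '' Set.Icc 0 1 = A ∧ f 0 = a ∧ f 1 = b

/-- Property S: for every `ε > 0`, `Ω` is a finite union of connected sets of diameter `< ε`. -/
def PropertyS (Ω : Set ℂ) : Prop :=
  ∀ ε > (0:ℝ), ∃ (k : ℕ) (N : Fin k → Set ℂ),
    (∀ i, IsConnected (N i) ∧ Metric.diam (N i) < ε) ∧ (⋃ i, N i) = Ω

/-- `x ∈ ∂Ω` is locally accessible from `Ω`. -/
def LocallyAccessible (Ω : Set ℂ) (x : ℂ) : Prop :=
  ∀ ε > (0:ℝ), ∃ δ > (0:ℝ), ∀ z ∈ Ω, dist z x < δ →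
    ∃ A : Set ℂ, IsArcFromTo A z x ∧ A ⊆ Ω ∪ {x} ∧ Metric.diam A < ε

/-- `ξ ∈ ∂Ω` is locally sequentially accessible. -/
def LocallySeqAccessible (Ω : Set ℂ) (ξ : ℂ) : Prop :=
  ∀ r > (0:ℝ), ∀ ξn : ℕ → ℂ, (∀ n, ξn n ∈ Ω) → Filter.Tendsto ξn Filter.atTop (nhds ξ) →
    ∃ x ∈ Ω ∩ Metric.ball ξ r,
      {n : ℕ | ξn n ∈ connectedComponentIn (Ω ∩ Metric.ball ξ r) x}.Infinite

/-- `Ω` is finitely connected at the boundary point `x`. -/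
def FinitelyConnectedAt (Ω : Set ℂ) (x : ℂ) : Prop :=
  ∀ r > (0:ℝ), ∃ U : Set ℂ, IsOpen U ∧ x ∈ U ∧ U ⊆ Metric.ball x r ∧
    {Q : Set ℂ | ∃ y ∈ U ∩ Ω, Q = connectedComponentIn (U ∩ Ω) y}.Finite

/-- The diameter (Mazurkiewicz) distance on `Ω`. -/
def mazDist (Ω : Set ℂ) (x y : ℂ) : ℝ :=
  sInf (Metric.diam '' {E : Set ℂ | E ⊆ Ω ∧ IsConnected E ∧ x ∈ E ∧ y ∈ E})

/-- `Ω` is totally bounded for the Mazurkiewicz distance; for a metric space this is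
equivalent to compactness of the metric completion of `(Ω, mazDist)`. -/
def MazCompletionCompact (Ω : Set ℂ) : Prop :=
  ∀ ε > (0:ℝ), ∃ F : Finset ℂ, ↑F ⊆ Ω ∧ ∀ x ∈ Ω, ∃ y ∈ F, mazDist Ω x y < ε

/-- `f : A → B` is non-alternating: there are no `x, y ∈ B` and no separation of
`A \ f⁻¹({x})` into two disjoint nonempty relatively open sets `A₁, A₂` with
`y ∈ f(A₁) ∩ f(A₂)`. -/
def NonAlternatingOn (f : ℂ → ℂ) (A B : Set ℂ) : Prop :=
  ¬ ∃ x ∈ B, ∃ y ∈ B, ∃ A₁ A₂ : Set ℂ,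
      A₁.Nonempty ∧ A₂.Nonempty ∧ Disjoint A₁ A₂ ∧
      A₁ ∪ A₂ = {z | z ∈ A ∧ f z ≠ x} ∧
      (∃ U₁ : Set ℂ, IsOpen U₁ ∧ A₁ = U₁ ∩ {z | z ∈ A ∧ f z ≠ x}) ∧
      (∃ U₂ : Set ℂ, IsOpen U₂ ∧ A₂ = U₂ ∩ {z | z ∈ A ∧ f z ≠ x}) ∧
      y ∈ f '' A₁ ∧ y ∈ f '' A₂

/-- An injective holomorphic function on an open set has nonvanishing derivative. -/
theorem deriv_ne_zero_of_injOn {f : ℂ → ℂ} {D : Set ℂ} (hD : IsOpen D)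
    (hf : DifferentiableOn ℂ f D) (hinj : InjOn f D) {a : ℂ} (ha : a ∈ D) : deriv f a ≠ 0 := by
  intro h0
  have han : AnalyticAt ℂ f a := hf.analyticAt (hD.mem_nhds ha)
  have hne : ¬ ∀ᶠ z in 𝓝 a, f z - f a = 0 := by
    intro hev
    have h1 : ∀ᶠ z in 𝓝[≠] a, f z - f a = 0 ∧ z ∈ D :=
      (hev.and (hD.mem_nhds ha)).filter_mono nhdsWithin_le_nhds
    obtain ⟨z, ⟨hz, hzD⟩, hza⟩ := (h1.and self_mem_nhdsWithin).exists
    exact hza (hinj hzD ha (sub_eq_zero.1 hz))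
  have hg : AnalyticAt ℂ (fun z => f z - f a) a := han.sub analyticAt_const
  have hne' : analyticOrderAt (fun z => f z - f a) a ≠ ⊤ := by
    rw [Ne, analyticOrderAt_eq_top]; exact hne
  obtain ⟨h, hh, hha, hfe⟩ := (hg.analyticOrderAt_ne_top).1 hne'
  set n := analyticOrderNatAt (fun z => f z - f a) a with hn
  have hn0 : n ≠ 0 := by
    intro h00
    have := hfe.self_of_nhds
    simp [h00] at this
    exact hha this.symm
  have hn1 : n ≠ 1 := by
    intro h1
    have hd : HasDerivAt (fun z => (z - a) ^ n • h z) (h a) a := by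
      rw [h1]
      have := ((hasDerivAt_id' a).sub_const a).fun_mul hh.differentiableAt.hasDerivAt
      simpa using this
    have hd2 : HasDerivAt (fun z => f z - f a) (deriv f a) a :=
      han.differentiableAt.hasDerivAt.sub_const _
    have := (hd.congr_of_eventuallyEq hfe).unique hd2
    exact hha (this.trans h0)
  obtain ⟨c, hc⟩ := IsAlgClosed.exists_pow_nat_eq (h a) (Nat.pos_of_ne_zero hn0)
  have hc0 : c ≠ 0 := by rintro rfl; simp [hn0] at hc; exact hha hc.symm
  set k : ℂ → ℂ := fun z => c * (h z / h a) ^ ((n : ℂ)⁻¹) with hk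
  have hquot : AnalyticAt ℂ (fun z => h z / h a) a := hh.div_const
  have hkan : AnalyticAt ℂ k a := by
    refine analyticAt_const.mul (hquot.cpow analyticAt_const ?_)
    simp [div_self hha]
  have hkpow : ∀ z, k z ^ n = h z := by
    intro z
    simp only [hk]
    rw [mul_pow, Complex.cpow_nat_inv_pow _ hn0, hc]
    field_simp
  have hka : k a ≠ 0 := by
    intro h; have := hkpow a; rw [h, zero_pow hn0] at this; exact hha this.symm
  set m : ℂ → ℂ := fun z => (z - a) * k z with hm
  have hman : AnalyticAt ℂ m a := (analyticAt_id.sub analyticAt_const).mul hkan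
  have hmd : HasDerivAt m (k a) a := by
    have := ((hasDerivAt_id' a).sub_const a).fun_mul hkan.differentiableAt.hasDerivAt
    simpa using this
  have hms : HasStrictDerivAt m (k a) a := by
    have := hman.hasStrictDerivAt
    rwa [hmd.deriv] at this
  have hmap := hms.map_nhds_eq hka
  have hma : m a = 0 := by simp [hm]
  have hV : {z | f z - f a = m z ^ n} ∩ D ∈ 𝓝 a := by
    refine inter_mem ?_ (hD.mem_nhds ha)
    filter_upwards [hfe] with z hz
    have hz' : f z - f a = (z - a) ^ n * h z := hz
    change f z - f a = ((z - a) * k z) ^ n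
    rw [mul_pow, hkpow, hz']
  have himg : m '' ({z | f z - f a = m z ^ n} ∩ D) ∈ 𝓝 (0 : ℂ) := by
    rw [← hma, ← hmap]; exact image_mem_map hV
  obtain ⟨ω, hω⟩ : ∃ ω : ℂ, IsPrimitiveRoot ω n := ⟨_, Complex.isPrimitiveRoot_exp n hn0⟩
  have hω1 : ω ≠ 1 := by
    intro h; exact hn1 ((IsPrimitiveRoot.iff_def _ _).1 hω |>.2 1 (by simp [h]) |> Nat.dvd_one.1)
  have himg2 : ∀ᶠ s in 𝓝 (0 : ℂ), ω * s ∈ m '' ({z | f z - f a = m z ^ n} ∩ D) := by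
    have : Tendsto (fun s : ℂ => ω * s) (𝓝 0) (𝓝 0) := by
      have : Continuous (fun s : ℂ => ω * s) := by fun_prop
      simpa using this.tendsto 0
    exact this himg
  have hev : ∀ᶠ s in 𝓝[≠] (0 : ℂ), s ∈ m '' ({z | f z - f a = m z ^ n} ∩ D) ∧
      ω * s ∈ m '' ({z | f z - f a = m z ^ n} ∩ D) :=
    ((show ∀ᶠ s in 𝓝 (0 : ℂ), s ∈ m '' _ from himg).and himg2).filter_mono nhdsWithin_le_nhds
  obtain ⟨s, ⟨⟨z, ⟨hz, hzD⟩, hzs⟩, ⟨w, ⟨hw, hwD⟩, hws⟩⟩, hs⟩ := (hev.and self_mem_nhdsWithin).exists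
  have : f z = f w := by
    have h1 : f z - f a = s ^ n := by rw [← hzs]; exact hz
    have h2 : f w - f a = s ^ n := by
      have : f w - f a = m w ^ n := hw
      rw [this, hws, mul_pow, hω.pow_eq_one, one_mul]
    exact sub_left_inj.1 (h1.trans h2.symm)
  have hzw := hinj hzD hwD this
  rw [hzw, hws] at hzs
  have hs0 : s ≠ 0 := hs
  exact hω1 (mul_right_cancel₀ hs0 (by rw [hzs, one_mul]))

/-- `f` has a continuous logarithm on `S`. -/
def HasContLog (f : ℂ → ℂ) (S : Set ℂ) : Prop :=
  ∃ L : ℂ → ℂ, ContinuousOn L S ∧ ∀ z ∈ S, Complex.exp (L z) = f z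

theorem HasContLog.congr {f g : ℂ → ℂ} {S : Set ℂ} (hf : HasContLog f S) (h : EqOn f g S) :
    HasContLog g S := by
  obtain ⟨L, hL, hLf⟩ := hf
  exact ⟨L, hL, fun z hz => (hLf z hz).trans (h hz)⟩

theorem HasContLog.mul {f g : ℂ → ℂ} {S : Set ℂ} (hf : HasContLog f S) (hg : HasContLog g S) :
    HasContLog (fun z => f z * g z) S := by
  obtain ⟨L, hL, hLf⟩ := hf
  obtain ⟨M, hM, hMg⟩ := hg
  exact ⟨fun z => L z + M z, hL.add hM, fun z hz => by rw [Complex.exp_add, hLf z hz, hMg z hz]⟩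

theorem HasContLog.inv {f : ℂ → ℂ} {S : Set ℂ} (hf : HasContLog f S) :
    HasContLog (fun z => (f z)⁻¹) S := by
  obtain ⟨L, hL, hLf⟩ := hf
  exact ⟨fun z => - L z, hL.neg, fun z hz => by rw [Complex.exp_neg, hLf z hz]⟩

theorem hasContLog_of_norm_sub_one_lt {f : ℂ → ℂ} {S : Set ℂ} (hf : ContinuousOn f S)
    (h : ∀ z ∈ S, ‖f z - 1‖ < 1) : HasContLog f S := by
  have hs : ∀ z ∈ S, f z ∈ Complex.slitPlane := fun z hz =>
    Complex.ball_one_subset_slitPlane (by simpa [dist_eq_norm] using h z hz)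
  exact ⟨fun z => Complex.log (f z), hf.clog hs,
    fun z hz => Complex.exp_log (Complex.slitPlane_ne_zero (hs z hz))⟩

/-- Homotopy invariance of having a continuous logarithm. -/
theorem hasContLog_div_of_isPreconnected {α : Type*} [TopologicalSpace α] {X : Set α}
    (hX : IsPreconnected X) {S : Set ℂ} (hS : IsCompact S) {h : α → ℂ → ℂ}
    (hc : ContinuousOn (fun p : α × ℂ => h p.1 p.2) (X ×ˢ S))
    (h0 : ∀ x ∈ X, ∀ z ∈ S, h x z ≠ 0) {x y : α} (hx : x ∈ X) (hy : y ∈ X) :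
    HasContLog (fun z => h x z / h y z) S := by
  have hcx : ∀ x ∈ X, ContinuousOn (h x) S := fun x hx =>
    hc.comp (f := fun z => (x, z)) (by fun_prop) (fun z hz => ⟨hx, hz⟩)
  refine hX.induction₂ (fun x y => HasContLog (fun z => h x z / h y z) S) ?_ ?_ ?_ hx hy
  · intro x hx
    have hcont : Continuous (fun p : X × S => h p.1 p.2) := by
      have := hc.comp_continuous (f := fun p : X × S => ((p.1 : α), (p.2 : ℂ))) (by fun_prop)
        (fun p => ⟨p.1.2, p.2.2⟩)
      exact this
    have : CompactSpace S := isCompact_iff_compactSpace.1 hS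
    have hcont2 : Continuous (fun p : X × S => ‖h x p.2 / h p.1 p.2 - 1‖) := by
      refine Continuous.norm (Continuous.sub (Continuous.div ?_ hcont
        fun p => h0 _ p.1.2 _ p.2.2) continuous_const)
      exact hcont.comp (f := fun p : X × S => ((⟨x, hx⟩ : X), p.2)) (by fun_prop)
    have hev := (isCompact_univ (X := S)).eventually_forall_of_forall_eventually
      (x₀ := (⟨x, hx⟩ : X)) (P := fun y z => ‖h x z / h y z - 1‖ < 1) (by
        intro z _
        refine (hcont2.tendsto ((⟨x, hx⟩ : X), z)).eventually_lt_const ?_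
        simp [div_self (h0 x hx z z.2)])
    rw [nhdsWithin_eq_map_subtype_coe hx, eventually_map]
    filter_upwards [hev] with y hy
    exact hasContLog_of_norm_sub_one_lt ((hcx x hx).div (hcx y y.2) (h0 y y.2))
      (fun z hz => hy ⟨z, hz⟩ (mem_univ _))
  · intro x y z hx hy hz hxy hyz
    refine (hxy.mul hyz).congr fun w hw => ?_
    have := h0 y hy w hw
    have := h0 z hz w hw
    simp only; field_simp
  · intro x y hx hy hxy
    exact hxy.inv.congr fun w hw => by simp

/-- The identity has no continuous logarithm on a circle around the origin. -/
theorem not_hasContLog_sphere {q : ℂ} {R : ℝ} (hR : 0 < R) :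
    ¬ HasContLog (fun z => z - q) (sphere q R) := by
  rintro ⟨L, hL, hLe⟩
  set k : ℝ → ℂ := fun t => (L (circleMap q R t) - (t * Complex.I + Real.log R)) with hk
  have hmem : ∀ t, circleMap q R t ∈ sphere q R := fun t => circleMap_mem_sphere q hR.le t
  have hkc : Continuous k := by
    have := hL.comp_continuous (continuous_circleMap q R) hmem
    exact this.sub (by fun_prop)
  have hkexp : ∀ t, Complex.exp (k t) = 1 := by
    intro t
    simp only [hk]
    rw [Complex.exp_sub, hLe _ (hmem t), Complex.exp_add, ← Complex.ofReal_exp, Real.exp_log hR]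
    have : (R : ℂ) ≠ 0 := by exact_mod_cast hR.ne'
    have h2 := Complex.exp_ne_zero (t * Complex.I)
    simp only [circleMap]
    field_simp
    ring
  set j : ℝ → ℝ := fun t => (k t).im / (2 * Real.pi) with hj
  have hjc : Continuous j := (Complex.continuous_im.comp hkc).div_const _
  have hjint : ∀ t, ∃ n : ℤ, j t = n := by
    intro t
    obtain ⟨n, hn⟩ := Complex.exp_eq_one_iff.1 (hkexp t)
    refine ⟨n, ?_⟩
    simp only [hj, hn]
    have : (2 * Real.pi) ≠ 0 := by positivity
    simp
  have h1 : j (2 * Real.pi) = j 0 - 1 := by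
    have hp : circleMap q R (2 * Real.pi) = circleMap q R 0 := by simp [circleMap]
    have : (2 * Real.pi) ≠ 0 := by positivity
    simp only [hj, hk, hp]
    field_simp
    simp
  obtain ⟨n, hn⟩ := hjint 0
  have hmemI : (n : ℝ) - 1 / 2 ∈ Icc (j (2 * Real.pi)) (j 0) := by
    rw [h1, hn]; constructor <;> linarith
  obtain ⟨t, -, ht⟩ := intermediate_value_Icc' (by positivity : (0:ℝ) ≤ 2 * Real.pi)
    hjc.continuousOn hmemI
  obtain ⟨m, hm⟩ := hjint t
  rw [hm] at ht
  have : (2 * m : ℝ) = 2 * n - 1 := by linarith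
  have : (2 * m : ℤ) = 2 * n - 1 := by exact_mod_cast this
  omega

theorem continuousOn_dslope_prod {f : ℂ → ℂ} {D : Set ℂ} (hD : IsOpen D)
    (hf : DifferentiableOn ℂ f D) :
    ContinuousOn (fun p : ℂ × ℂ => dslope f p.1 p.2) (D ×ˢ D) := by
  rintro ⟨a, b⟩ ⟨ha, hb⟩
  refine ContinuousAt.continuousWithinAt ?_
  by_cases hab : b = a
  · subst hab
    have hstrict : HasStrictDerivAt f (deriv f b) b :=
      (hf.analyticAt (hD.mem_nhds hb)).hasStrictDerivAt
    have hdc : ContinuousAt (deriv f) b := (hf.analyticAt (hD.mem_nhds hb)).deriv.continuousAt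
    have hdc' : Tendsto (fun p : ℂ × ℂ => deriv f p.1) (𝓝 (b, b)) (𝓝 (deriv f b)) :=
      hdc.tendsto.comp (continuous_fst.tendsto (b, b))
    rw [ContinuousAt, Metric.tendsto_nhds]
    intro ε hε
    have h1 := hstrict.isLittleO.def (half_pos hε)
    have h2 := Metric.tendsto_nhds.1 hdc' ε hε
    filter_upwards [h1, h2] with p hp1 hp2
    rw [dslope_same]
    by_cases hp : p.2 = p.1
    · rw [hp, dslope_same]; exact hp2
    · rw [dslope_of_ne _ hp, slope_comm, slope_def_field, dist_eq_norm]
      have hne : p.1 - p.2 ≠ 0 := sub_ne_zero.2 (Ne.symm hp)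
      have hpos : 0 < ‖p.1 - p.2‖ := norm_pos_iff.2 hne
      have : (f p.1 - f p.2) / (p.1 - p.2) - deriv f b
          = (f p.1 - f p.2 - (p.1 - p.2) * deriv f b) / (p.1 - p.2) := by field_simp
      rw [this, norm_div, div_lt_iff₀ hpos]
      have hp1' : ‖f p.1 - f p.2 - (p.1 - p.2) * deriv f b‖ ≤ ε / 2 * ‖p.1 - p.2‖ := by
        simpa [mul_comm] using hp1
      nlinarith
  · have h1 : (fun p : ℂ × ℂ => (f p.2 - f p.1) / (p.2 - p.1)) =ᶠ[𝓝 (a, b)]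
        (fun p : ℂ × ℂ => dslope f p.1 p.2) := by
      have : ∀ᶠ p : ℂ × ℂ in 𝓝 (a, b), p.2 - p.1 ≠ 0 :=
        (by fun_prop : Continuous fun p : ℂ × ℂ => p.2 - p.1).continuousAt.eventually_ne
          (sub_ne_zero.2 hab)
      filter_upwards [this] with p hp
      rw [dslope_of_ne _ (sub_ne_zero.1 hp), slope_def_field]
    refine ContinuousAt.congr ?_ h1
    have ca : ContinuousAt f a := (hf.differentiableAt (hD.mem_nhds ha)).continuousAt
    have cb : ContinuousAt f b := (hf.differentiableAt (hD.mem_nhds hb)).continuousAt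
    refine ContinuousAt.div ?_ (by fun_prop) (sub_ne_zero.2 hab)
    exact (ContinuousAt.comp (f := Prod.snd) (x := (a, b)) cb continuousAt_snd).sub
      (ContinuousAt.comp (f := Prod.fst) (x := (a, b)) ca continuousAt_fst)

theorem dslope_ne_zero_of_injOn {f : ℂ → ℂ} {D : Set ℂ} (hD : IsOpen D)
    (hf : DifferentiableOn ℂ f D) (hinj : InjOn f D) {a b : ℂ} (ha : a ∈ D) (hb : b ∈ D) :
    dslope f a b ≠ 0 := by
  by_cases hab : b = a
  · subst hab; rw [dslope_same]; exact deriv_ne_zero_of_injOn hD hf hinj hb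
  · rw [dslope_of_ne _ hab, slope_def_field]
    exact div_ne_zero (sub_ne_zero.2 fun h => hab (hinj hb ha h)) (sub_ne_zero.2 hab)

/-- Two points in different components of a compact set can be separated by a partition into
compact sets. -/
theorem exists_compact_partition {K : Set ℂ} (hK : IsCompact K) {a b : ℂ} (ha : a ∈ K)
    (hb : b ∈ K) (hab : b ∉ connectedComponentIn K a) :
    ∃ A B : Set ℂ, IsCompact A ∧ IsCompact B ∧ Disjoint A B ∧ A ∪ B = K ∧ a ∈ A ∧ b ∈ B := by
  have : CompactSpace K := isCompact_iff_compactSpace.1 hK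
  rw [connectedComponentIn_eq_image ha, connectedComponent_eq_iInter_isClopen] at hab
  have : ∃ s : Set K, IsClopen s ∧ (⟨a, ha⟩ : K) ∈ s ∧ (⟨b, hb⟩ : K) ∉ s := by
    by_contra! hcon
    refine hab ⟨⟨b, hb⟩, ?_, rfl⟩
    rw [mem_iInter]
    rintro ⟨s, hs, has⟩
    exact hcon s hs has
  obtain ⟨s, hs, has, hbs⟩ := this
  refine ⟨(↑) '' s, (↑) '' sᶜ, hs.isClosed.isCompact.image continuous_subtype_val,
    hs.compl.isClosed.isCompact.image continuous_subtype_val, ?_, ?_, ⟨_, has, rfl⟩, ⟨_, hbs, rfl⟩⟩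
  · rw [disjoint_image_iff Subtype.val_injective]; exact disjoint_compl_right
  · rw [← image_union, union_compl_self, image_univ, Subtype.range_coe]

theorem not_hasContLog_of_partition {A B : Set ℂ} (hA : IsCompact A) (hB : IsCompact B)
    (hAB : Disjoint A B) {a b : ℂ} (ha : a ∈ A) (hb : b ∈ B) :
    ∃ S : Set ℂ, IsCompact S ∧ Disjoint S (A ∪ B) ∧
      ¬ HasContLog (fun z => (z - a) / (z - b)) S := by
  have hAne : A.Nonempty := ⟨a, ha⟩
  obtain ⟨δ, hδ, hδAB⟩ : ∃ δ > 0, ∀ z ∈ B, δ ≤ infDist z A := by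
    obtain ⟨z, hz, hmin⟩ := hB.exists_isMinOn ⟨b, hb⟩ (continuous_infDist_pt A).continuousOn
    refine ⟨infDist z A, ?_, fun w hw => hmin hw⟩
    exact (hA.isClosed.notMem_iff_infDist_pos hAne).1 (disjoint_right.1 hAB hz)
  set d : ℂ → ℝ := fun z => infDist z A with hd
  have hdc : Continuous d := continuous_infDist_pt A
  have hda : ∀ z, d z ≠ 0 → z ≠ a := by
    rintro z hz rfl; exact hz (infDist_zero_of_mem ha)
  have hbd : ∀ z, d z < δ → z ≠ b := by
    rintro z hz rfl; exact absurd (hδAB _ hb) (not_le.2 hz)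
  obtain ⟨R0, hR0⟩ := hA.isBounded.subset_closedBall a
  have hbig : ∀ C : ℝ, Bornology.IsBounded {z | d z ≤ C} := by
    intro C
    refine (isBounded_closedBall (x := a) (r := C + 1 + R0)).subset fun z hz => ?_
    obtain ⟨w, hw, hzw⟩ := (infDist_lt_iff hAne).1 (lt_of_le_of_lt hz (lt_add_one C))
    have := hR0 hw
    rw [mem_closedBall] at this ⊢
    linarith [dist_triangle z w a]
  set S : Set ℂ := {z | δ / 3 ≤ d z ∧ d z ≤ 2 * δ / 3} with hS
  have hScl : IsClosed S := (isClosed_le continuous_const hdc).inter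
    (isClosed_le hdc continuous_const)
  refine ⟨S, Metric.isCompact_of_isClosed_isBounded hScl
    ((hbig (2 * δ / 3)).subset fun z hz => hz.2), ?_, ?_⟩
  · rw [disjoint_left]
    rintro z ⟨hz1, hz2⟩ (hz | hz)
    · have : d z = 0 := infDist_zero_of_mem hz
      linarith
    · have := hδAB z hz
      change δ ≤ d z at this
      linarith
  rintro ⟨L, hL, hLe⟩
  obtain ⟨M, hM⟩ := ContinuousMap.exists_restrict_eq hScl ⟨S.domRestrict L, hL.domRestrict⟩
  have hML : ∀ z ∈ S, M z = L z := fun z hz => congrArg (fun g => g ⟨z, hz⟩) hM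
  set χ : ℂ → ℝ := fun z => max 0 (min 1 (2 - 3 * d z / δ)) with hχ
  have hχc : Continuous χ := by fun_prop
  set F1 : ℂ → ℂ := fun z => (z - a) * Complex.exp (- (χ z * M z)) with hF1
  have hF1c : Continuous F1 := by
    have := M.continuous
    fun_prop
  set F : ℂ → ℂ := fun z => if d z ≤ δ / 3 then z - b else F1 z with hF
  have hFc : Continuous F := by
    refine Continuous.if_le (by fun_prop) hF1c hdc continuous_const ?_
    intro z hz
    have hzS : z ∈ S := ⟨hz.ge, by linarith⟩
    have hχ1 : χ z = 1 := by
      have : 2 - 3 * d z / δ = 1 := by rw [hz]; field_simp; norm_num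
      simp [hχ, this]
    have h1 : z - a ≠ 0 := sub_ne_zero.2 (hda z (by rw [hz]; positivity))
    have h2 : z - b ≠ 0 := sub_ne_zero.2 (hbd z (by rw [hz]; linarith))
    simp only [hF1, hχ1]
    rw [Complex.ofReal_one, one_mul, Complex.exp_neg, hML z hzS, hLe z hzS]
    field_simp
  have hF0 : ∀ z, F z ≠ 0 := by
    intro z
    simp only [hF]
    split_ifs with h
    · exact sub_ne_zero.2 (hbd z (by linarith))
    · exact mul_ne_zero (sub_ne_zero.2 (hda z (by push Not at h; linarith))) (Complex.exp_ne_zero _)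
  obtain ⟨R, hR⟩ := (hbig δ).subset_closedBall a
  set R' : ℝ := max R 0 + 1 with hR'
  have hR'pos : 0 < R' := by positivity
  refine not_hasContLog_sphere (q := a) hR'pos ?_
  have hFS : EqOn F (fun z => z - a) (sphere a R') := by
    intro z hz
    have hdz : δ < d z := by
      by_contra! hcon
      have h1 : dist z a ≤ R := hR hcon
      have h2 : dist z a = R' := hz
      have := le_max_left R 0
      linarith
    have hχ0 : χ z = 0 := by
      have : 2 - 3 * d z / δ ≤ 0 := by
        rw [sub_nonpos, le_div_iff₀ hδ]; linarith
      simp only [hχ]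
      exact max_eq_left (le_trans (min_le_right _ _) this)
    simp only [hF, hF1, hχ0]
    rw [if_neg (by linarith)]
    simp
  have key := hasContLog_div_of_isPreconnected (X := Icc (0 : ℝ) 1) isPreconnected_Icc
    (isCompact_sphere a R') (h := fun t z => F (a + t * (z - a))) (x := 1) (y := 0)
    (Continuous.continuousOn (by fun_prop)) (fun _ _ _ _ => hF0 _) (by simp) (by simp)
  have hconst : HasContLog (fun _ => F a) (sphere a R') :=
    ⟨fun _ => Complex.log (F a), continuousOn_const, fun _ _ => Complex.exp_log (hF0 a)⟩
  refine (key.mul hconst).congr fun z hz => ?_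
  refine Eq.trans ?_ (hFS hz)
  have := hF0 a
  simp [this]

/-- A pair of mutually inverse holomorphic maps between bounded planar domains. -/
structure ConfPair (φ ψ : ℂ → ℂ) (D Ω : Set ℂ) : Prop where
  isOpen_left : IsOpen D
  isOpen_right : IsOpen Ω
  conn_left : IsConnected D
  conn_right : IsConnected Ω
  bdd_left : Bornology.IsBounded D
  bdd_right : Bornology.IsBounded Ω
  diff_left : DifferentiableOn ℂ φ D
  diff_right : DifferentiableOn ℂ ψ Ω
  maps_left : MapsTo φ D Ω
  maps_right : MapsTo ψ Ω D
  inv_left : ∀ z ∈ D, ψ (φ z) = z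
  inv_right : ∀ w ∈ Ω, φ (ψ w) = w

theorem ConfPair.symm {φ ψ : ℂ → ℂ} {D Ω : Set ℂ} (h : ConfPair φ ψ D Ω) : ConfPair ψ φ Ω D :=
  ⟨h.2, h.1, h.4, h.3, h.6, h.5, h.8, h.7, h.10, h.9, h.12, h.11⟩

theorem ConfPair.injOn {φ ψ : ℂ → ℂ} {D Ω : Set ℂ} (h : ConfPair φ ψ D Ω) : InjOn φ D :=
  fun z hz w hw hzw => by rw [← h.inv_left z hz, hzw, h.inv_left w hw]

theorem exists_confPair {φ : ℂ → ℂ} {D Ω : Set ℂ} (hD : IsPlanarDomain D)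
    (hDb : Bornology.IsBounded D) (hΩ : IsPlanarDomain Ω) (hΩb : Bornology.IsBounded Ω)
    (hφ : IsConformalHomeoOnto φ D Ω) : ∃ ψ, ConfPair φ ψ D Ω := by
  obtain ⟨hd, hbij⟩ := hφ
  set ψ := Function.invFunOn φ D with hψ
  have hl : ∀ z ∈ D, ψ (φ z) = z := fun z hz => hbij.injOn.leftInvOn_invFunOn hz
  have hr : ∀ w ∈ Ω, φ (ψ w) = w := fun w hw => Function.invFunOn_eq (hbij.surjOn hw)
  have hm : MapsTo ψ Ω D := fun w hw => Function.invFunOn_mem (hbij.surjOn hw)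
  have hmap : ∀ z ∈ D, map φ (𝓝 z) = 𝓝 (φ z) := fun z hz =>
    ((hd.analyticAt (hD.2.1.mem_nhds hz)).hasStrictDerivAt).map_nhds_eq
      (deriv_ne_zero_of_injOn hD.2.1 hd hbij.injOn hz)
  refine ⟨ψ, hD.2.1, hΩ.2.1, hD.2.2, hΩ.2.2, hDb, hΩb, hd, ?_, hbij.mapsTo, hm, hl, hr⟩
  intro w hw
  have hzD := hm hw
  have hca : ContinuousAt ψ w := by
    intro V hV
    have h1 : φ '' (V ∩ D) ∈ 𝓝 w := by
      have := hmap _ hzD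
      rw [hr w hw] at this
      rw [← this]
      exact image_mem_map (inter_mem hV (hD.2.1.mem_nhds hzD))
    rw [mem_map]
    filter_upwards [h1]
    rintro _ ⟨z, ⟨hzV, hz⟩, rfl⟩
    rwa [mem_preimage, hl z hz]
  have hder := ((hd.differentiableAt (hD.2.1.mem_nhds hzD)).hasDerivAt)
  refine (HasDerivAt.of_local_left_inverse hca hder
    (deriv_ne_zero_of_injOn hD.2.1 hd hbij.injOn hzD) ?_).differentiableAt.differentiableWithinAt
  filter_upwards [hΩ.2.1.mem_nhds hw] with v hv using hr v hv

/-- The closure of the graph of `φ` over `D`. -/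
def graphClosure (φ : ℂ → ℂ) (D : Set ℂ) : Set (ℂ × ℂ) := closure ((fun z => (z, φ z)) '' D)

theorem mem_graphClosure {φ : ℂ → ℂ} {D : Set ℂ} {q p : ℂ} :
    (q, p) ∈ graphClosure φ D ↔ ∀ ε > 0, ∃ a ∈ D, dist a q < ε ∧ dist (φ a) p < ε := by
  rw [graphClosure, Metric.mem_closure_iff]
  refine forall₂_congr fun ε hε => ?_
  simp [Prod.dist_eq, dist_comm]

theorem mem_clusterSet_iff {φ : ℂ → ℂ} {D : Set ℂ} {q p : ℂ} :
    p ∈ clusterSet φ D q ↔ (q, p) ∈ graphClosure φ D := by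
  rw [mem_graphClosure]
  simp only [clusterSet, mem_iInter, Metric.mem_closure_iff]
  constructor
  · intro h ε hε
    obtain ⟨_, ⟨a, ⟨haD, haq⟩, rfl⟩, hap⟩ := h ε hε ε hε
    exact ⟨a, haD, haq, by rwa [dist_comm]⟩
  · intro h r hr ε hε
    obtain ⟨a, haD, haq, hap⟩ := h (min r ε) (lt_min hr hε)
    exact ⟨_, ⟨a, ⟨haD, haq.trans_le (min_le_left _ _)⟩, rfl⟩, by
      rw [dist_comm]; exact hap.trans_le (min_le_right _ _)⟩

namespace ConfPair

variable {φ ψ : ℂ → ℂ} {D Ω : Set ℂ}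

theorem graph_symm (h : ConfPair φ ψ D Ω) {q p : ℂ} (hqp : (q, p) ∈ graphClosure φ D) :
    (p, q) ∈ graphClosure ψ Ω := by
  rw [mem_graphClosure] at hqp ⊢
  intro ε hε
  obtain ⟨a, ha, h1, h2⟩ := hqp ε hε
  exact ⟨φ a, h.maps_left ha, h2, by rwa [h.inv_left a ha]⟩

theorem isCompact_graphClosure (h : ConfPair φ ψ D Ω) : IsCompact (graphClosure φ D) := by
  refine Metric.isCompact_of_isClosed_isBounded isClosed_closure ?_
  refine Bornology.IsBounded.closure ((h.bdd_left.prod h.bdd_right).subset ?_)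
  rintro _ ⟨z, hz, rfl⟩
  exact ⟨hz, h.maps_left hz⟩

theorem exists_graph (h : ConfPair φ ψ D Ω) {q : ℂ} (hq : q ∈ closure D) :
    ∃ p, (q, p) ∈ graphClosure φ D := by
  have h1 : IsClosed (Prod.fst '' graphClosure φ D) :=
    (h.isCompact_graphClosure.image continuous_fst).isClosed
  have h2 : D ⊆ Prod.fst '' graphClosure φ D := fun z hz =>
    ⟨(z, φ z), subset_closure ⟨z, hz, rfl⟩, rfl⟩
  obtain ⟨⟨q', p⟩, hqp, rfl⟩ := closure_minimal h2 h1 hq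
  exact ⟨p, hqp⟩

theorem eq_of_graph (h : ConfPair φ ψ D Ω) {q p : ℂ} (hqp : (q, p) ∈ graphClosure φ D)
    (hq : q ∈ D) : φ q = p := by
  have hc : ContinuousAt φ q :=
    (h.diff_left.differentiableAt (h.isOpen_left.mem_nhds hq)).continuousAt
  rw [mem_graphClosure] at hqp
  refine eq_of_forall_dist_le fun ε hε => ?_
  obtain ⟨δ, hδ, hδc⟩ := Metric.continuousAt_iff.1 hc (ε / 2) (half_pos hε)
  obtain ⟨a, ha, h1, h2⟩ := hqp (min δ (ε / 2)) (lt_min hδ (half_pos hε))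
  have := hδc (h1.trans_le (min_le_left _ _))
  have := h2.trans_le (min_le_right _ _)
  have := dist_triangle (φ q) (φ a) p
  rw [dist_comm (φ q) (φ a)] at this
  linarith

theorem frontier_of_graph (h : ConfPair φ ψ D Ω) {q p : ℂ} (hqp : (q, p) ∈ graphClosure φ D)
    (hq : q ∈ frontier D) : p ∈ frontier Ω := by
  have hqD : q ∉ D := by rw [h.isOpen_left.frontier_eq] at hq; exact hq.2
  rw [h.isOpen_right.frontier_eq]
  refine ⟨?_, fun hp => hqD ?_⟩
  · rw [Metric.mem_closure_iff]
    intro ε hε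
    obtain ⟨a, ha, -, h2⟩ := mem_graphClosure.1 hqp ε hε
    exact ⟨φ a, h.maps_left ha, by rwa [dist_comm]⟩
  · rw [← h.symm.eq_of_graph (h.graph_symm hqp) hp]
    exact h.maps_right hp

theorem hasContLog_of_compact (h : ConfPair φ ψ D Ω) {q₁ q₂ p₁ p₂ : ℂ}
    (hq₁ : q₁ ∈ frontier D) (hq₂ : q₂ ∈ frontier D) (h₁ : (q₁, p₁) ∈ graphClosure φ D)
    (h₂ : (q₂, p₂) ∈ graphClosure φ D) (hp : p₂ ∈ connectedComponentIn Ωᶜ p₁)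
    {S : Set ℂ} (hS : IsCompact S) (hSD : S ⊆ D) :
    HasContLog (fun z => (z - q₁) / (z - q₂)) S := by
  have hp₂ := connectedComponentIn_subset _ _ hp
  have hp₁ : p₁ ∈ Ωᶜ := connectedComponentIn_nonempty_iff.1 ⟨_, hp⟩
  have hD := h.isOpen_left
  have hφc : ContinuousOn φ S := h.diff_left.continuousOn.mono hSD
  have hφS : IsCompact (φ '' S) := hS.image_of_continuousOn hφc
  have hφSΩ : φ '' S ⊆ Ω := by rintro _ ⟨z, hz, rfl⟩; exact h.maps_left (hSD hz)
  have hq₁D : q₁ ∉ D := by rw [hD.frontier_eq] at hq₁; exact hq₁.2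
  have hq₂D : q₂ ∉ D := by rw [hD.frontier_eq] at hq₂; exact hq₂.2
  have sep : ∀ (K : Set ℂ), IsCompact K → ∀ q ∉ K, ∃ δ > 0, ∀ z ∈ K, ∀ w ∈ ball q δ, z ≠ w := by
    intro K hK q hq
    obtain ⟨δ, hδ, hδK⟩ := Metric.isOpen_iff.1 hK.isClosed.isOpen_compl q hq
    exact ⟨δ, hδ, fun z hz w hw hzw => hδK hw (hzw ▸ hz)⟩
  have chain : ∀ (X : Set ℂ), IsPreconnected X → ∀ f : ℂ → ℂ, ContinuousOn f S →
      (∀ z ∈ S, ∀ w ∈ X, f z ≠ w) → ∀ x ∈ X, ∀ y ∈ X,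
      HasContLog (fun z => (f z - x) / (f z - y)) S := by
    intro X hX f hf hfX x hx y hy
    refine hasContLog_div_of_isPreconnected hX hS (h := fun x z => f z - x) ?_
      (fun x hx z hz => sub_ne_zero.2 (hfX z hz x hx)) hx hy
    exact (hf.comp continuousOn_snd fun p hp => hp.2).sub continuousOn_fst
  have point : ∀ q p, q ∉ D → p ∉ Ω → (q, p) ∈ graphClosure φ D → ∃ a ∈ D, (a ∉ S) ∧
      HasContLog (fun z => (φ z - φ a) / (φ z - p)) S ∧
      HasContLog (fun z => (z - q) / (z - a)) S := by
    intro q p hq hp hqp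
    obtain ⟨δ₁, hδ₁, hs₁⟩ := sep S hS q fun hqS => hq (hSD hqS)
    obtain ⟨δ₂, hδ₂, hs₂⟩ := sep _ hφS p fun hpS => hp (hφSΩ hpS)
    obtain ⟨a, ha, h1, h2⟩ := mem_graphClosure.1 hqp (min δ₁ δ₂) (lt_min hδ₁ hδ₂)
    have h1' : a ∈ ball q δ₁ := h1.trans_le (min_le_left _ _)
    have h2' : φ a ∈ ball p δ₂ := h2.trans_le (min_le_right _ _)
    refine ⟨a, ha, fun haS => hs₁ a haS a h1' rfl, ?_, ?_⟩
    · exact chain (ball p δ₂) (convex_ball _ _).isPreconnected φ hφc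
        (fun z hz => hs₂ _ ⟨z, hz, rfl⟩) _ h2' _ (mem_ball_self hδ₂)
    · exact chain (ball q δ₁) (convex_ball _ _).isPreconnected id continuousOn_id
        hs₁ _ (mem_ball_self hδ₁) _ h1'
  obtain ⟨a, ha, haS, ha1, ha2⟩ := point q₁ p₁ hq₁D hp₁ h₁
  obtain ⟨b, hb, hbS, hb1, hb2⟩ := point q₂ p₂ hq₂D hp₂ h₂
  have hpp : HasContLog (fun z => (φ z - p₁) / (φ z - p₂)) S :=
    chain _ isPreconnected_connectedComponentIn φ hφc
      (fun z hz w hw hzw => (connectedComponentIn_subset _ _ hw : w ∈ Ωᶜ)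
        (hzw ▸ h.maps_left (hSD hz)))
      _ (mem_connectedComponentIn hp₁) _ hp
  have hslope : HasContLog (fun z => dslope φ b z / dslope φ a z) S := by
    refine hasContLog_div_of_isPreconnected h.conn_left.isPreconnected hS
      (h := fun x z => dslope φ x z) ((continuousOn_dslope_prod hD h.diff_left).mono
        (prod_mono_right hSD)) (fun x hx z hz => ?_) hb ha
    exact dslope_ne_zero_of_injOn hD h.diff_left h.injOn hx (hSD hz)
  refine (((((ha1.mul hpp).mul hb1.inv).mul hslope).mul ha2).mul hb2.inv).congr fun z hz => ?_
  have hza : z ≠ a := fun hh => haS (hh ▸ hz)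
  have hzb : z ≠ b := fun hh => hbS (hh ▸ hz)
  have e1 := sub_ne_zero.2 hza
  have e2 := sub_ne_zero.2 hzb
  have e3 : z - q₂ ≠ 0 := sub_ne_zero.2 fun hh => hq₂D (hh ▸ hSD hz)
  have e4 : φ z - p₁ ≠ 0 := sub_ne_zero.2 fun hh => hp₁ (hh ▸ h.maps_left (hSD hz))
  have e5 : φ z - p₂ ≠ 0 := sub_ne_zero.2 fun hh => hp₂ (hh ▸ h.maps_left (hSD hz))
  have e6 : φ z - φ a ≠ 0 := sub_ne_zero.2 fun hh => hza (h.injOn (hSD hz) ha hh)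
  have e7 : φ z - φ b ≠ 0 := sub_ne_zero.2 fun hh => hzb (h.injOn (hSD hz) hb hh)
  simp only [dslope_of_ne _ hza, dslope_of_ne _ hzb, slope_def_field]
  field_simp

/-- Boundary points of `D` that cluster at the same component of the complement of `Ω` lie in the
same component of the boundary of `D`. -/
theorem mem_component_left (h : ConfPair φ ψ D Ω) {q₁ q₂ p₁ p₂ : ℂ}
    (hq₁ : q₁ ∈ frontier D) (hq₂ : q₂ ∈ frontier D) (h₁ : (q₁, p₁) ∈ graphClosure φ D)
    (h₂ : (q₂, p₂) ∈ graphClosure φ D) (hp : p₂ ∈ connectedComponentIn Ωᶜ p₁) :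
    q₂ ∈ connectedComponentIn (frontier D) q₁ := by
  by_contra hcon
  have hK : IsCompact (frontier D) := Metric.isCompact_of_isClosed_isBounded isClosed_frontier
    (h.bdd_left.closure.subset frontier_subset_closure)
  obtain ⟨A, B, hA, hB, hAB, hABK, haA, hbB⟩ := exists_compact_partition hK hq₁ hq₂ hcon
  obtain ⟨S, hS, hSd, hno⟩ := not_hasContLog_of_partition hA hB hAB haA hbB
  rw [hABK] at hSd
  have hSfr : ∀ z ∈ S, z ∈ closure D → z ∈ D := by
    intro z hz hzc
    by_contra hzD
    exact disjoint_left.1 hSd hz (by rw [h.isOpen_left.frontier_eq]; exact ⟨hzc, hzD⟩)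
  have hS1 : IsCompact (S ∩ closure D) := hS.inter_right isClosed_closure
  have hS2 : IsCompact (S ∩ Dᶜ) := hS.inter_right h.isOpen_left.isClosed_compl
  obtain ⟨L, hL, hLe⟩ := h.hasContLog_of_compact hq₁ hq₂ h₁ h₂ hp hS1 fun z hz => hSfr z hz.1 hz.2
  obtain ⟨M, hM, hMe⟩ : HasContLog (fun z => (z - q₁) / (z - q₂)) (S ∩ Dᶜ) := by
    refine hasContLog_div_of_isPreconnected (X := closure D)
      h.conn_left.isPreconnected.closure hS2 (h := fun x z => z - x)
      (Continuous.continuousOn (by fun_prop)) (fun x hx z hz hzx => ?_)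
      (frontier_subset_closure hq₁) (frontier_subset_closure hq₂)
    rw [sub_eq_zero] at hzx
    exact hz.2 (hSfr z hz.1 (hzx ▸ hx))
  classical
  refine hno ⟨fun z => if z ∈ D then L z else M z, ?_, ?_⟩
  · have hSu : S = (S ∩ closure D) ∪ (S ∩ Dᶜ) := by
      ext z
      simp only [mem_union, mem_inter_iff, mem_compl_iff]
      have : z ∈ D → z ∈ closure D := fun h => subset_closure h
      tauto
    rw [hSu]
    refine ContinuousOn.union_of_isClosed ?_ ?_ hS1.isClosed hS2.isClosed
    · exact hL.congr fun z hz => if_pos (hSfr z hz.1 hz.2)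
    · exact hM.congr fun z hz => if_neg hz.2
  · intro z hz
    by_cases hzD : z ∈ D
    · simpa [hzD] using hLe z ⟨hz, subset_closure hzD⟩
    · simpa [hzD] using hMe z ⟨hz, hzD⟩

theorem mem_component_right (h : ConfPair φ ψ D Ω) {q₁ q₂ p₁ p₂ : ℂ}
    (hq₁ : q₁ ∈ frontier D) (hq₂ : q₂ ∈ frontier D) (h₁ : (q₁, p₁) ∈ graphClosure φ D)
    (h₂ : (q₂, p₂) ∈ graphClosure φ D) (hq : q₂ ∈ connectedComponentIn Dᶜ q₁) :
    p₂ ∈ connectedComponentIn (frontier Ω) p₁ :=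
  h.symm.mem_component_left (h.frontier_of_graph h₁ hq₁) (h.frontier_of_graph h₂ hq₂)
    (h.graph_symm h₁) (h.graph_symm h₂) hq

end ConfPair

/-- A segment that leaves a component of the complement of an open set does so through a boundary
point of the open set. -/
theorem exists_exit {D : Set ℂ} (hD : IsOpen D) {z z' : ℂ} (hz : z ∈ Dᶜ)
    (hz' : z' ∉ connectedComponentIn Dᶜ z) :
    ∃ q ∈ segment ℝ z z', q ∈ frontier D ∧ q ∈ connectedComponentIn Dᶜ z := by
  set ℓ : ℝ → ℂ := fun t => AffineMap.lineMap z z' t with hℓ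
  have hℓc : Continuous ℓ := AffineMap.lineMap_continuous
  set S : Set ℝ := Icc 0 1 ∩ ℓ ⁻¹' D with hS
  have key : ∀ t ∈ Icc (0 : ℝ) 1, (∀ s ∈ Icc 0 t, ℓ s ∉ D) → ℓ t ∈ connectedComponentIn Dᶜ z := by
    intro t ht h
    have h1 : IsPreconnected (ℓ '' Icc 0 t) := isPreconnected_Icc.image _ hℓc.continuousOn
    refine h1.subset_connectedComponentIn ⟨0, ⟨le_rfl, ht.1⟩, by simp [hℓ]⟩ ?_
      ⟨t, ⟨ht.1, le_rfl⟩, rfl⟩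
    rintro _ ⟨s, hs, rfl⟩
    exact h s hs
  have hne : S.Nonempty := by
    by_contra hcon
    refine hz' ?_
    have := key 1 ⟨zero_le_one, le_rfl⟩ fun s hs hsD => hcon ⟨s, hs, hsD⟩
    simpa [hℓ] using this
  have hbdd : BddBelow S := ⟨0, fun t ht => ht.1.1⟩
  set t := sInf S with ht
  have ht0 : 0 ≤ t := le_csInf hne fun s hs => hs.1.1
  have ht1 : t ≤ 1 := by obtain ⟨s, hs⟩ := hne; exact (csInf_le hbdd hs).trans hs.1.2
  have hlt : ∀ s ∈ Ico 0 t, ℓ s ∉ D := fun s hs hsD =>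
    notMem_of_lt_csInf hs.2 hbdd ⟨⟨hs.1, hs.2.le.trans ht1⟩, hsD⟩
  have htD : ℓ t ∉ D := by
    rcases ht0.eq_or_lt with h0 | h0
    · rw [← h0]; simpa [hℓ] using hz
    · have hcl : IsClosed (ℓ ⁻¹' Dᶜ) := hD.isClosed_compl.preimage hℓc
      have : Icc 0 t ⊆ ℓ ⁻¹' Dᶜ := by
        rw [← closure_Ico h0.ne]
        exact closure_minimal hlt hcl
      exact this ⟨ht0, le_rfl⟩
  refine ⟨ℓ t, ?_, ?_, ?_⟩
  · rw [segment_eq_image_lineMap]; exact ⟨t, ⟨ht0, ht1⟩, rfl⟩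
  · rw [hD.frontier_eq]
    refine ⟨?_, htD⟩
    have h1 : t ∈ closure S := csInf_mem_closure hne hbdd
    have h2 : S ⊆ ℓ ⁻¹' closure D := fun s hs => subset_closure hs.2
    exact closure_minimal h2 (isClosed_closure.preimage hℓc) h1
  · refine key t ⟨ht0, ht1⟩ fun s hs => ?_
    rcases hs.2.eq_or_lt with h | h
    · rwa [h]
    · exact hlt s ⟨hs.1, h⟩

/-- The boundary component of `Ω` that corresponds under `φ : D → Ω` to the component of the
complement of `D` containing `z`. -/
def impression (φ : ℂ → ℂ) (D Ω : Set ℂ) (z : ℂ) : Set ℂ :=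
  {w | ∃ q p, q ∈ frontier D ∧ q ∈ connectedComponentIn Dᶜ z ∧ (q, p) ∈ graphClosure φ D ∧
    w ∈ connectedComponentIn (frontier Ω) p}

theorem impression_congr {φ : ℂ → ℂ} {D Ω : Set ℂ} {z z' : ℂ}
    (h : connectedComponentIn Dᶜ z = connectedComponentIn Dᶜ z') :
    impression φ D Ω z = impression φ D Ω z' := by
  simp only [impression, h]

namespace ConfPair

variable {φ ψ : ℂ → ℂ} {D Ω : Set ℂ}

theorem exists_mem_impression (h : ConfPair φ ψ D Ω) {z z' : ℂ} (hz : z ∈ Dᶜ)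
    (hz' : z' ∉ connectedComponentIn Dᶜ z) : ∃ q p, q ∈ segment ℝ z z' ∧ q ∈ frontier D ∧
      q ∈ connectedComponentIn Dᶜ z ∧ (q, p) ∈ graphClosure φ D ∧ p ∈ impression φ D Ω z := by
  obtain ⟨q, hqs, hqD, hqz⟩ := exists_exit h.isOpen_left hz hz'
  obtain ⟨p, hp⟩ := h.exists_graph (frontier_subset_closure hqD)
  exact ⟨q, p, hqs, hqD, hqz, hp, q, p, hqD, hqz, hp,
    mem_connectedComponentIn (h.frontier_of_graph hp hqD)⟩

theorem impression_eq (h : ConfPair φ ψ D Ω) {z w : ℂ} (hw : w ∈ impression φ D Ω z) :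
    impression φ D Ω z = connectedComponentIn (frontier Ω) w := by
  obtain ⟨q, p, hq, hqz, hqp, hwp⟩ := hw
  rw [← connectedComponentIn_eq hwp]
  ext w'
  refine ⟨?_, fun hw' => ⟨q, p, hq, hqz, hqp, hw'⟩⟩
  rintro ⟨q', p', hq', hqz', hqp', hwp'⟩
  have h1 : q' ∈ connectedComponentIn Dᶜ q := by rwa [← connectedComponentIn_eq hqz]
  have h2 := h.mem_component_right hq hq' hqp hqp' h1
  rwa [connectedComponentIn_eq h2]

theorem impression_subset (z : ℂ) : impression φ D Ω z ⊆ frontier Ω := by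
  rintro w ⟨q, p, -, -, -, hw⟩
  exact connectedComponentIn_subset _ _ hw

theorem impression_nonempty (h : ConfPair φ ψ D Ω) {z : ℂ} (hz : z ∈ Dᶜ) :
    (impression φ D Ω z).Nonempty := by
  obtain ⟨x, hx⟩ := h.conn_left.nonempty
  obtain ⟨_, p, _, _, _, _, hp⟩ := h.exists_mem_impression hz
    (z' := x) fun hc => connectedComponentIn_subset _ _ hc hx
  exact ⟨p, hp⟩

theorem isPreconnected_impression (h : ConfPair φ ψ D Ω) (z : ℂ) :
    IsPreconnected (impression φ D Ω z) := by
  rcases (impression φ D Ω z).eq_empty_or_nonempty with he | ⟨w, hw⟩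
  · rw [he]; exact isPreconnected_empty
  · rw [h.impression_eq hw]; exact isPreconnected_connectedComponentIn

/-- Distinct components of the complement of `D` have disjoint impressions. -/
theorem component_eq_of_impression (h : ConfPair φ ψ D Ω) {z z' w : ℂ}
    (hw : w ∈ impression φ D Ω z) (hw' : w ∈ impression φ D Ω z') :
    connectedComponentIn Dᶜ z = connectedComponentIn Dᶜ z' := by
  obtain ⟨q, p, hq, hqz, hqp, hwp⟩ := hw
  obtain ⟨q', p', hq', hqz', hqp', hwp'⟩ := hw'
  have hΩ : frontier Ω ⊆ Ωᶜ := by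
    rw [h.isOpen_right.frontier_eq]; exact fun x hx => hx.2
  have hD : frontier D ⊆ Dᶜ := by
    rw [h.isOpen_left.frontier_eq]; exact fun x hx => hx.2
  have h1 : p' ∈ connectedComponentIn Ωᶜ p := by
    refine connectedComponentIn_mono _ hΩ ?_
    rw [connectedComponentIn_eq hwp, ← connectedComponentIn_eq hwp']
    exact mem_connectedComponentIn (h.frontier_of_graph hqp' hq')
  have h2 := connectedComponentIn_mono _ hD (h.mem_component_left hq hq' hqp hqp' h1)
  rw [connectedComponentIn_eq hqz, connectedComponentIn_eq hqz', connectedComponentIn_eq h2]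

theorem exists_ball_lt (h : ConfPair φ ψ D Ω) {π : ℂ → ℝ} (hπ : Continuous π) {z : ℂ}
    {c : ℝ} (hc : ∀ p, (z, p) ∈ graphClosure φ D → π p < c) :
    ∃ δ > 0, ∀ z' ∈ ball z δ, ∀ p, (z', p) ∈ graphClosure φ D → π p < c := by
  have hK : IsCompact (graphClosure φ D ∩ {x | c ≤ π x.2}) :=
    h.isCompact_graphClosure.inter_right (isClosed_le continuous_const (by fun_prop))
  have hK1 : IsClosed (Prod.fst '' (graphClosure φ D ∩ {x | c ≤ π x.2})) :=
    (hK.image continuous_fst).isClosed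
  have hz : z ∈ (Prod.fst '' (graphClosure φ D ∩ {x | c ≤ π x.2}))ᶜ := by
    rintro ⟨⟨_, p⟩, ⟨hp, hpc⟩, rfl⟩
    exact (hc p hp).not_ge hpc
  obtain ⟨δ, hδ, hsub⟩ := Metric.isOpen_iff.1 hK1.isOpen_compl z hz
  refine ⟨δ, hδ, fun z' hz' p hp => ?_⟩
  by_contra hcon
  exact hsub hz' ⟨(z', p), ⟨hp, not_lt.1 hcon⟩, rfl⟩

/-- A strict upper bound for the values at `z` (the image point in `D`, the impression off `D`)
bounds some value at each nearby point. -/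
theorem exists_ball_impression_lt (h : ConfPair φ ψ D Ω) {π : ℂ → ℝ} (hπ : Continuous π) {c : ℝ} {z : ℂ}
    (hz : (z ∈ D → π (φ z) < c) ∧ (z ∉ D → ∀ w ∈ impression φ D Ω z, π w < c)) :
    ∃ δ > 0, ∀ z' ∈ ball z δ,
      (z' ∈ D → π (φ z') < c) ∧ (z' ∉ D → ∃ w ∈ impression φ D Ω z', π w < c) := by
  have hgr : ∀ p, (z, p) ∈ graphClosure φ D → π p < c := by
    intro p hp
    by_cases hzD : z ∈ D
    · rw [← h.eq_of_graph hp hzD]; exact hz.1 hzD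
    · have hzf : z ∈ frontier D := by
        rw [h.isOpen_left.frontier_eq]
        refine ⟨?_, hzD⟩
        rw [Metric.mem_closure_iff]
        intro ε hε
        obtain ⟨a, ha, h1, -⟩ := mem_graphClosure.1 hp ε hε
        exact ⟨a, ha, by rwa [dist_comm]⟩
      exact hz.2 hzD p ⟨z, p, hzf, mem_connectedComponentIn hzD, hp,
        mem_connectedComponentIn (h.frontier_of_graph hp hzf)⟩
  obtain ⟨δ, hδ, hsub⟩ := h.exists_ball_lt hπ hgr
  refine ⟨δ, hδ, fun z' hz' => ⟨fun hD => ?_, fun hD => ?_⟩⟩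
  · exact hsub z' hz' _ (subset_closure ⟨z', hD, rfl⟩)
  · by_cases hzz : z ∈ connectedComponentIn Dᶜ z'
    · have hzD : z ∈ Dᶜ := connectedComponentIn_subset _ _ hzz
      rw [impression_congr (connectedComponentIn_eq hzz)]
      obtain ⟨w, hw⟩ := h.impression_nonempty hzD
      exact ⟨w, hw, hz.2 hzD w hw⟩
    · obtain ⟨q, p, hqs, -, -, hqp, hp⟩ := h.exists_mem_impression hD hzz
      exact ⟨p, hp, hsub q ((convex_ball z δ).segment_subset hz' (mem_ball_self hδ) hqs) p hqp⟩

/-- Along a connected set, the values of `φ` together with the impressions of the complementary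
components that are met have the intermediate value property. -/
theorem exists_crossing (h : ConfPair φ ψ D Ω) {π : ℂ → ℝ} (hπ : Continuous π) {G : Set ℂ}
    (hG : IsPreconnected G) {x y : ℂ} (hx : x ∈ G ∩ D) (hy : y ∈ G ∩ D) {c : ℝ}
    (hxc : π (φ x) < c) (hyc : c < π (φ y)) :
    ∃ z ∈ G, (z ∈ D ∧ π (φ z) = c) ∨ (z ∉ D ∧ ∃ w ∈ impression φ D Ω z, π w = c) := by
  by_contra! hcon
  set A : Set ℂ := {z | (z ∈ D → π (φ z) < c) ∧ (z ∉ D → ∃ w ∈ impression φ D Ω z, π w < c)}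
  set B : Set ℂ := {z | (z ∈ D → -π (φ z) < -c) ∧
    (z ∉ D → ∃ w ∈ impression φ D Ω z, -π w < -c)}
  have hside : ∀ z ∈ G, z ∉ D → (∀ w ∈ impression φ D Ω z, π w < c) ∨
      (∀ w ∈ impression φ D Ω z, -π w < -c) := by
    intro z hzG hzD
    by_contra! hh
    obtain ⟨⟨w, hw, hwc⟩, w', hw', hwc'⟩ := hh
    obtain ⟨w'', hw'', hc⟩ := (h.isPreconnected_impression z).intermediate_value hw' hw
      hπ.continuousOn (⟨by linarith, hwc⟩ : c ∈ Icc (π w') (π w))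
    exact (hcon z hzG).2 hzD w'' hw'' hc
  have hdisj : ∀ z ∈ G, z ∈ A → z ∈ B → False := by
    intro z hz hA hB
    by_cases hzD : z ∈ D
    · linarith [hA.1 hzD, hB.1 hzD]
    · obtain ⟨w, hw, hwc⟩ := hA.2 hzD
      obtain ⟨w', hw', hwc'⟩ := hB.2 hzD
      rcases hside z hz hzD with h1 | h1
      · linarith [h1 w' hw']
      · linarith [h1 w hw]
  have hA1 : ∀ z ∈ G, z ∈ A → (z ∈ D → π (φ z) < c) ∧
      (z ∉ D → ∀ w ∈ impression φ D Ω z, π w < c) := by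
    intro z hz hA
    refine ⟨hA.1, fun hzD => ?_⟩
    obtain ⟨w, hw, hwc⟩ := hA.2 hzD
    refine (hside z hz hzD).resolve_right fun h1 => ?_
    linarith [h1 w hw]
  have hB1 : ∀ z ∈ G, z ∈ B → (z ∈ D → -π (φ z) < -c) ∧
      (z ∉ D → ∀ w ∈ impression φ D Ω z, -π w < -c) := by
    intro z hz hB
    refine ⟨hB.1, fun hzD => ?_⟩
    obtain ⟨w, hw, hwc⟩ := hB.2 hzD
    refine (hside z hz hzD).resolve_left fun h1 => ?_
    linarith [h1 w hw]
  have hcov : G ⊆ interior A ∪ interior B := by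
    intro z hz
    have hAB : z ∈ A ∨ z ∈ B := by
      by_cases hzD : z ∈ D
      · rcases lt_or_gt_of_ne ((hcon z hz).1 hzD) with h1 | h1
        · exact Or.inl ⟨fun _ => h1, fun hh => (hh hzD).elim⟩
        · exact Or.inr ⟨fun _ => neg_lt_neg h1, fun hh => (hh hzD).elim⟩
      · obtain ⟨w, hw⟩ := h.impression_nonempty hzD
        exact (hside z hz hzD).imp (fun h1 => ⟨fun hh => (hzD hh).elim, fun _ => ⟨w, hw, h1 w hw⟩⟩)
          (fun h1 => ⟨fun hh => (hzD hh).elim, fun _ => ⟨w, hw, h1 w hw⟩⟩)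
    refine hAB.imp (fun hA => ?_) fun hB => ?_
    · obtain ⟨δ, hδ, hsub⟩ := h.exists_ball_impression_lt hπ (hA1 z hz hA)
      exact mem_interior.2 ⟨ball z δ, hsub, isOpen_ball, mem_ball_self hδ⟩
    · obtain ⟨δ, hδ, hsub⟩ := h.exists_ball_impression_lt hπ.neg (hB1 z hz hB)
      exact mem_interior.2 ⟨ball z δ, hsub, isOpen_ball, mem_ball_self hδ⟩
  have hxA : x ∈ A := ⟨fun _ => hxc, fun hh => (hh hx.2).elim⟩
  have hyB : y ∈ B := ⟨fun _ => neg_lt_neg hyc, fun hh => (hh hy.2).elim⟩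
  obtain ⟨z, hzG, hzA, hzB⟩ := hG _ _ isOpen_interior isOpen_interior hcov
    ⟨x, hx.1, (hcov hx.1).resolve_right fun hh => hdisj x hx.1 hxA (interior_subset hh)⟩
    ⟨y, hy.1, (hcov hy.1).resolve_left fun hh => hdisj y hy.1 (interior_subset hh) hyB⟩
  exact hdisj z hzG (interior_subset hzA) (interior_subset hzB)

end ConfPair

theorem isClosed_connectedComponentIn {K : Set ℂ} (hK : IsClosed K) (x : ℂ) :
    IsClosed (connectedComponentIn K x) := by
  by_cases hx : x ∈ K
  · refine isClosed_of_closure_subset ?_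
    refine isPreconnected_connectedComponentIn.closure.subset_connectedComponentIn
      (subset_closure (mem_connectedComponentIn hx)) ?_
    exact closure_minimal (connectedComponentIn_subset _ _) hK
  · rw [connectedComponentIn_eq_empty hx]; exact isClosed_empty

theorem mem_connectedComponentIn_of_tendsto {K : Set ℂ} (hK : IsCompact K) {u v : ℕ → ℂ} {a b : ℂ}
    (hv : ∀ n, v n ∈ connectedComponentIn K (u n)) (hua : Tendsto u atTop (𝓝 a))
    (hvb : Tendsto v atTop (𝓝 b)) : b ∈ connectedComponentIn K a := by
  have huK : ∀ n, u n ∈ K := fun n => connectedComponentIn_nonempty_iff.1 ⟨_, hv n⟩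
  have hvK : ∀ n, v n ∈ K := fun n => connectedComponentIn_subset _ _ (hv n)
  have haK : a ∈ K := hK.isClosed.mem_of_tendsto hua (Eventually.of_forall huK)
  have hbK : b ∈ K := hK.isClosed.mem_of_tendsto hvb (Eventually.of_forall hvK)
  by_contra hcon
  obtain ⟨A, B, hA, hB, hAB, rfl, haA, hbB⟩ := exists_compact_partition hK haK hbK hcon
  have h1 : ∀ᶠ n in atTop, u n ∈ Bᶜ :=
    hua.eventually (hB.isClosed.isOpen_compl.mem_nhds (disjoint_left.1 hAB haA))
  have h2 : ∀ᶠ n in atTop, v n ∈ Aᶜ :=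
    hvb.eventually (hA.isClosed.isOpen_compl.mem_nhds (disjoint_right.1 hAB hbB))
  obtain ⟨n, hn1, hn2⟩ := (h1.and h2).exists
  rcases isPreconnected_iff_subset_of_disjoint_closed.1
    (isPreconnected_connectedComponentIn (F := A ∪ B) (x := u n)) A B hA.isClosed hB.isClosed
    (connectedComponentIn_subset _ _) (by rw [hAB.inter_eq, inter_empty]) with h3 | h3
  · exact hn2 (h3 (hv n))
  · exact hn1 (h3 (mem_connectedComponentIn (huK n)))

theorem isPreconnected_sphere_halfPlane (z₀ a : ℂ) {r : ℝ} (hr : 0 < r) (t : ℝ) :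
    IsPreconnected {z | z ∈ sphere z₀ r ∧ t < ((z - z₀) * (starRingEnd ℂ) a).re} := by
  have hsph : IsPreconnected (sphere z₀ r) := by
    refine isPreconnected_sphere ?_ _ _
    rw [Complex.rank_real_complex]; norm_num
  by_cases ha : a = 0
  · subst ha
    by_cases ht : t < 0
    · convert hsph using 1
      ext z
      simp [ht]
    · simpa [ht] using isPreconnected_empty
  have ha' : (starRingEnd ℂ) a ≠ 0 := (map_ne_zero _).2 ha
  have hna : 0 < r * ‖a‖ := mul_pos hr (norm_pos_iff.2 ha)
  set g : ℝ → ℂ := fun θ => z₀ + (r * ‖a‖ : ℝ) * Complex.exp (θ * Complex.I) / (starRingEnd ℂ) a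
  have hg : Continuous g := by fun_prop
  have hgmul : ∀ θ, (g θ - z₀) * (starRingEnd ℂ) a = (r * ‖a‖ : ℝ) * Complex.exp (θ * Complex.I) := by
    intro θ
    simp only [g, add_sub_cancel_left]
    field_simp
  have hgre : ∀ θ, ((g θ - z₀) * (starRingEnd ℂ) a).re = r * ‖a‖ * Real.cos θ := by
    intro θ
    rw [hgmul, Complex.re_ofReal_mul, Complex.exp_ofReal_mul_I_re]
  have hconn : IsPreconnected (Icc (-Real.pi) Real.pi ∩ {θ | t < r * ‖a‖ * Real.cos θ}) := by
    refine OrdConnected.isPreconnected ⟨?_⟩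
    rintro x ⟨hx, hxt⟩ y ⟨hy, hyt⟩ θ hθ
    have hθI : θ ∈ Icc (-Real.pi) Real.pi := ⟨hx.1.trans hθ.1, hθ.2.trans hy.2⟩
    refine ⟨hθI, ?_⟩
    have mono : ∀ s ∈ Icc (-Real.pi) Real.pi, |θ| ≤ |s| → Real.cos s ≤ Real.cos θ := by
      intro s hs hsθ
      rw [← Real.cos_abs s, ← Real.cos_abs θ]
      exact Real.cos_le_cos_of_nonneg_of_le_pi (abs_nonneg _) (abs_le.2 hs) hsθ
    rcases le_max_iff.1 (abs_le_max_abs_abs hθ.1 hθ.2) with h1 | h1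
    · exact lt_of_lt_of_le hxt (mul_le_mul_of_nonneg_left (mono x hx h1) hna.le)
    · exact lt_of_lt_of_le hyt (mul_le_mul_of_nonneg_left (mono y hy h1) hna.le)
  convert hconn.image g hg.continuousOn using 1
  ext z
  constructor
  · rintro ⟨hz, hzt⟩
    set w := (z - z₀) * (starRingEnd ℂ) a
    have hw : ‖w‖ = r * ‖a‖ := by
      rw [norm_mul, RCLike.norm_conj, ← dist_eq_norm, mem_sphere.1 hz]
    have hgz : g w.arg = z := by
      have := Complex.norm_mul_exp_arg_mul_I w
      simp only [g, ← hw, this]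
      simp only [w]
      field_simp
      ring
    refine ⟨w.arg, ⟨⟨(Complex.neg_pi_lt_arg w).le, Complex.arg_le_pi w⟩, ?_⟩, hgz⟩
    change t < r * ‖a‖ * Real.cos w.arg
    rw [← hgre, hgz]; exact hzt
  · rintro ⟨θ, ⟨-, hθ⟩, rfl⟩
    refine ⟨?_, ?_⟩
    · rw [mem_sphere, dist_eq_norm]
      have := congrArg norm (hgmul θ)
      rw [norm_mul, RCLike.norm_conj, norm_mul, Complex.norm_exp_ofReal_mul_I, mul_one,
        Complex.norm_real, Real.norm_of_nonneg hna.le] at this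
      exact mul_right_cancel₀ (norm_ne_zero_iff.2 ha) this
    · rw [hgre]; exact hθ

theorem dist_sq_of_mem_sphere {z₀ c z : ℂ} {r : ℝ} (hz : z ∈ sphere z₀ r) :
    dist z c ^ 2 = r ^ 2 + ‖z₀ - c‖ ^ 2 + 2 * ((z - z₀) * (starRingEnd ℂ) (z₀ - c)).re := by
  rw [mem_sphere, dist_eq_norm] at hz
  rw [dist_eq_norm, ← hz, show z - c = (z - z₀) + (z₀ - c) by ring, ← Complex.normSq_eq_norm_sq,
    ← Complex.normSq_eq_norm_sq, ← Complex.normSq_eq_norm_sq, Complex.normSq_add]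

theorem isPreconnected_sphere_diff {D : Set ℂ} (hD : IsCircleDomain D) {z₀ : ℂ} (hz₀ : z₀ ∈ Dᶜ)
    {r : ℝ} (hr : 0 < r) : IsPreconnected (sphere z₀ r \ connectedComponentIn Dᶜ z₀) := by
  have h := hD.2.2 z₀ hz₀
  by_cases hb : Bornology.IsBounded (connectedComponentIn Dᶜ z₀)
  · rcases h.1 hb with hs | ⟨c, ρ, hρ, hs⟩
    · have : sphere z₀ r \ {z₀} = sphere z₀ r :=
        sdiff_singleton_eq_self fun hh => hr.ne (by simpa using hh)
      rw [hs, this]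
      refine isPreconnected_sphere ?_ _ _
      rw [Complex.rank_real_complex]; norm_num
    · rw [hs]
      convert isPreconnected_sphere_halfPlane z₀ (z₀ - c) hr ((ρ ^ 2 - r ^ 2 - ‖z₀ - c‖ ^ 2) / 2)
        using 1
      ext z
      refine and_congr_right fun hz => ?_
      rw [mem_closedBall, not_le, ← sq_lt_sq₀ hρ.le dist_nonneg, dist_sq_of_mem_sphere hz]
      constructor <;> intro h <;> linarith
  · obtain ⟨c, ρ, hρ, hs⟩ := h.2 hb
    rw [hs]
    convert isPreconnected_sphere_halfPlane z₀ (-(z₀ - c)) hr (-(ρ ^ 2 - r ^ 2 - ‖z₀ - c‖ ^ 2) / 2)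
      using 1
    ext z
    refine and_congr_right fun hz => ?_
    rw [mem_compl_iff, not_not, mem_ball, ← sq_lt_sq₀ dist_nonneg hρ.le, dist_sq_of_mem_sphere hz,
      map_neg, mul_neg, Complex.neg_re]
    constructor <;> intro h <;> linarith

namespace ConfPair

variable {φ ψ : ℂ → ℂ} {D Ω : Set ℂ}

/-- Any given boundary component of `Ω` is avoided by the impressions near `z₀`, apart from the
impression at `z₀` itself. -/
theorem exists_ball_notMem_impression (h : ConfPair φ ψ D Ω) (z₀ w : ℂ) :
    ∃ δ > 0, ∀ z ∈ ball z₀ δ, z ∈ Dᶜ → z ∉ connectedComponentIn Dᶜ z₀ →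
      w ∉ impression φ D Ω z := by
  by_contra! hcon
  obtain ⟨z₁, -, hz₁, hz₁', hw₁⟩ := hcon 1 one_pos
  have hz₀₁ : z₀ ∉ connectedComponentIn Dᶜ z₁ := fun hh =>
    hz₁' (connectedComponentIn_eq hh ▸ mem_connectedComponentIn hz₁)
  obtain ⟨δ, hδ, hsub⟩ := Metric.isOpen_iff.1
    (isClosed_connectedComponentIn h.isOpen_left.isClosed_compl z₁).isOpen_compl z₀ hz₀₁
  obtain ⟨z, hz, hzD, -, hw⟩ := hcon δ hδ
  exact hsub hz (h.component_eq_of_impression hw hw₁ ▸ mem_connectedComponentIn hzD)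

/-- Impressions near `z₀` are contained in any neighbourhood of the boundary component of `Ω`
corresponding to that of `z₀`. -/
theorem exists_ball_impression_subset (h : ConfPair φ ψ D Ω) {z₀ : ℂ} (hz₀ : z₀ ∈ frontier D)
    {U : Set ℂ} (hU : IsOpen U)
    (hQU : boundaryComp φ D (connectedComponentIn (frontier D) z₀) ⊆ U) :
    ∃ δ > 0, ∀ z ∈ ball z₀ δ, z ∈ Dᶜ → z ∉ connectedComponentIn Dᶜ z₀ →
      impression φ D Ω z ⊆ U := by
  by_contra! hcon
  have hDc : frontier D ⊆ Dᶜ := by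
    rw [h.isOpen_left.frontier_eq]; exact fun x hx => hx.2
  have hΩc : frontier Ω ⊆ Ωᶜ := by
    rw [h.isOpen_right.frontier_eq]; exact fun x hx => hx.2
  have hz₀D : z₀ ∈ Dᶜ := hDc hz₀
  have key : ∀ n : ℕ, ∃ q q' w, q ∈ ball z₀ (1 / (n + 1 : ℝ)) ∧
      q' ∈ connectedComponentIn (frontier D) q ∧ (q', w) ∈ graphClosure φ D ∧ w ∉ U := by
    intro n
    obtain ⟨z, hz, hzD, hzn, hzU⟩ := hcon (1 / (n + 1 : ℝ)) (by positivity)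
    obtain ⟨w, hw, hwU⟩ := not_subset.1 hzU
    have hz₀z : z₀ ∉ connectedComponentIn Dᶜ z := fun hh =>
      hzn (connectedComponentIn_eq hh ▸ mem_connectedComponentIn hzD)
    obtain ⟨q, p, hqs, hqD, hqz, hqp, hp⟩ := h.exists_mem_impression hzD hz₀z
    have hwΩ : w ∈ frontier Ω := impression_subset z hw
    obtain ⟨q', hq'⟩ := h.symm.exists_graph (frontier_subset_closure hwΩ)
    have hq'w := h.symm.graph_symm hq'
    refine ⟨q, q', w, ?_, ?_, hq'w, hwU⟩
    · exact (convex_ball _ _).segment_subset hz (mem_ball_self (by positivity)) hqs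
    · refine h.mem_component_left hqD (h.symm.frontier_of_graph hq' hwΩ) hqp hq'w ?_
      rw [h.impression_eq hp] at hw
      exact connectedComponentIn_mono _ hΩc hw
  choose q q' w hq hq' hqw hw using key
  obtain ⟨⟨b, p⟩, hbp, s, hs, hlim⟩ := h.isCompact_graphClosure.tendsto_subseq hqw
  have hq₀ : Tendsto q atTop (𝓝 z₀) := by
    rw [tendsto_iff_dist_tendsto_zero]
    exact squeeze_zero (fun _ => dist_nonneg) (fun n => (mem_ball.1 (hq n)).le)
      tendsto_one_div_add_atTop_nhds_zero_nat
  have hK : IsCompact (frontier D) := Metric.isCompact_of_isClosed_isBounded isClosed_frontier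
    (h.bdd_left.closure.subset frontier_subset_closure)
  have hb : b ∈ connectedComponentIn (frontier D) z₀ :=
    mem_connectedComponentIn_of_tendsto hK (fun n => hq' (s n)) (hq₀.comp hs.tendsto_atTop)
      ((continuous_fst.tendsto _).comp hlim)
  have hpU : p ∈ U := hQU (mem_iUnion₂.2 ⟨b, hb, mem_clusterSet_iff.2 hbp⟩)
  have hpU' : p ∈ Uᶜ := hU.isClosed_compl.mem_of_tendsto ((continuous_snd.tendsto _).comp hlim)
    (Eventually.of_forall fun n => hw (s n))
  exact hpU' hpU

end ConfPair

/-- The union of the impressions of the points of `∂B(z₀, r)` that lie in the complement of `D`, but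
not in its component containing `z₀`. -/
def sphereImpression (φ : ℂ → ℂ) (D Ω : Set ℂ) (z₀ : ℂ) (r : ℝ) : Set ℂ :=
  {w | ∃ z ∈ sphere z₀ r, z ∈ Dᶜ ∧ z ∉ connectedComponentIn Dᶜ z₀ ∧ w ∈ impression φ D Ω z}

theorem nonempty_interior_of_isCircleDomain {D : Set ℂ} (hD : IsCircleDomain D) {z z' : ℂ}
    (hz : z ∈ Dᶜ) (hz' : z' ∈ connectedComponentIn Dᶜ z) (hne : z' ≠ z) :
    (interior (connectedComponentIn Dᶜ z)).Nonempty := by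
  have h := hD.2.2 z hz
  by_cases hb : Bornology.IsBounded (connectedComponentIn Dᶜ z)
  · rcases h.1 hb with hs | ⟨c, ρ, hρ, hs⟩
    · rw [hs] at hz'; exact (hne hz').elim
    · rw [hs]
      exact ⟨c, interior_mono ball_subset_closedBall (by rw [isOpen_ball.interior_eq]; exact mem_ball_self hρ)⟩
  · obtain ⟨c, ρ, hρ, hs⟩ := h.2 hb
    have hsub : (closedBall c ρ)ᶜ ⊆ connectedComponentIn Dᶜ z := by
      rw [hs]; exact compl_subset_compl.2 ball_subset_closedBall
    refine ⟨c + (ρ + 1 : ℝ), interior_maximal hsub isClosed_closedBall.isOpen_compl ?_⟩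
    have : |ρ + 1| = ρ + 1 := abs_of_pos (by linarith)
    simp [dist_eq_norm, -Complex.ofReal_add, this]

theorem LipschitzWith.volume_image_le_ediam {π : ℂ → ℝ} (hπ : LipschitzWith 1 π) (s : Set ℂ) :
    volume (π '' s) ≤ ediam s := by
  refine (Real.volume_le_diam _).trans ?_
  simpa using hπ.ediam_image_le s

theorem LipschitzWith.volume_image_eq_zero {π : ℂ → ℝ} (hπ : LipschitzWith 1 π) {s : Set ℂ}
    (hs : μH[1] s = 0) : volume (π '' s) = 0 := by
  rw [← hausdorffMeasure_real]
  refine le_antisymm ((hπ.hausdorffMeasure_image_le zero_le_one s).trans ?_) zero_le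
  simp [hs]

namespace ConfPair

variable {φ ψ : ℂ → ℂ} {D Ω : Set ℂ}

theorem eventually_volume_image_le (h : ConfPair φ ψ D Ω) {z₀ : ℂ} (hz₀ : z₀ ∈ frontier D)
    (hcount : (NondegComponents (frontier Ω)).Countable) {U : Set ℂ} (hU : IsOpen U)
    (hQU : boundaryComp φ D (connectedComponentIn (frontier D) z₀) ⊆ U)
    (hsum : ∑' Q' : {Q' : Set ℂ // Q' ∈ NondegComponents (frontier Ω) ∧ Q' ⊆ U},
      ediam (Q' : Set ℂ) < ⊤) {ε : ENNReal} (hε : 0 < ε) :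
    ∀ᶠ r in 𝓝[>] (0 : ℝ), ∀ π : ℂ → ℝ, LipschitzWith 1 π →
      volume (π '' (sphereImpression φ D Ω z₀ r \ SingletonPart (frontier Ω))) ≤ ε := by
  set X := {Q' : Set ℂ // Q' ∈ NondegComponents (frontier Ω) ∧ Q' ⊆ U}
  have hX : Countable X := (hcount.mono fun Q' (hQ' : Q' ∈ NondegComponents (frontier Ω) ∧ Q' ⊆ U)
    => hQ'.1).to_subtype
  obtain ⟨s, hs⟩ := ((ENNReal.tendsto_tsum_compl_atTop_zero hsum.ne).eventually
    (gt_mem_nhds hε)).exists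
  have hradius : ∀ {p : ℂ → Prop}, (∃ δ > 0, ∀ z ∈ ball z₀ δ, p z) →
      ∀ᶠ r in 𝓝[>] (0 : ℝ), ∀ z ∈ sphere z₀ r, p z := by
    rintro p ⟨δ, hδ, hp⟩
    filter_upwards [Ioo_mem_nhdsGT hδ] with r hr z hz
    exact hp z (sphere_subset_ball hr.2 hz)
  have h1 : ∀ᶠ r in 𝓝[>] (0 : ℝ), ∀ Q' ∈ s, ∀ z ∈ sphere z₀ r, z ∈ Dᶜ →
      z ∉ connectedComponentIn Dᶜ z₀ → impression φ D Ω z ≠ Q' := by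
    rw [Finset.eventually_all]
    rintro ⟨Q', ⟨⟨x, hx, rfl⟩, -⟩, -⟩ -
    filter_upwards [hradius (h.exists_ball_notMem_impression z₀ x)] with r hr z hz hzD hzn heq
    exact hr z hz hzD hzn (heq ▸ mem_connectedComponentIn hx)
  filter_upwards [h1, hradius (h.exists_ball_impression_subset hz₀ hU hQU)] with r hr1 hr2 π hπ
  have hsub : sphereImpression φ D Ω z₀ r \ SingletonPart (frontier Ω) ⊆
      ⋃ Q' : {Q' : X // Q' ∉ s}, (Q' : X).1 := by
    rintro w ⟨⟨z, hz, hzD, hzn, hw⟩, hwS⟩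
    have hwΩ : w ∈ frontier Ω := impression_subset z hw
    have heq := h.impression_eq hw
    have hnd : ∃ b ∈ connectedComponentIn (frontier Ω) w, b ≠ w := by
      by_contra! hcon
      exact hwS ⟨hwΩ, Subset.antisymm hcon (singleton_subset_iff.2 (mem_connectedComponentIn hwΩ))⟩
    obtain ⟨b, hb, hbw⟩ := hnd
    have hmem : impression φ D Ω z ∈ NondegComponents (frontier Ω) :=
      ⟨⟨w, hwΩ, heq⟩, b, heq ▸ hb, w, hw, hbw⟩
    exact mem_iUnion.2 ⟨⟨⟨_, hmem, hr2 z hz hzD hzn⟩, fun hQs => hr1 _ hQs z hz hzD hzn rfl⟩, hw⟩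
  calc volume (π '' (sphereImpression φ D Ω z₀ r \ SingletonPart (frontier Ω)))
      ≤ volume (⋃ Q' : {Q' : X // Q' ∉ s}, π '' (Q' : X).1) := by
        rw [← image_iUnion]; exact measure_mono (image_mono hsub)
    _ ≤ ∑' Q' : {Q' : X // Q' ∉ s}, volume (π '' (Q' : X).1) := measure_iUnion_le _
    _ ≤ ∑' Q' : {Q' : X // Q' ∉ s}, ediam (Q' : X).1 :=
        ENNReal.tsum_le_tsum fun Q' => hπ.volume_image_le_ediam _
    _ ≤ ε := hs.le

/-- For all but countably many radii the impressions met by the circle of radius `r` contribute a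
null set of singleton components. -/
theorem exists_countable_volume_image_eq_zero (h : ConfPair φ ψ D Ω) (hD : IsCircleDomain D)
    (z₀ : ℂ) (hsing : SigmaFiniteH1 (SingletonPart (frontier Ω))) :
    ∃ B : Set ℝ, B.Countable ∧ ∀ r ∉ B, ∀ π : ℂ → ℝ, LipschitzWith 1 π →
      volume (π '' (sphereImpression φ D Ω z₀ r ∩ SingletonPart (frontier Ω))) = 0 := by
  set 𝒞 : Set (Set ℂ) := {C | ∃ z ∈ Dᶜ, C = connectedComponentIn Dᶜ z ∧ (interior C).Nonempty}
  have h𝒞 : 𝒞.Countable := by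
    refine PairwiseDisjoint.countable_of_nonempty_interior (s := id) ?_ fun C hC => ?_
    · rintro _ ⟨z, -, rfl, -⟩ _ ⟨z', -, rfl, -⟩ hne
      refine disjoint_left.2 fun w hw hw' => hne ?_
      rw [connectedComponentIn_eq hw, connectedComponentIn_eq hw']
    · obtain ⟨_, _, _, hC⟩ := hC; exact hC
  set N : Set ℂ := ⋃ C ∈ 𝒞, {p | p ∈ SingletonPart (frontier Ω) ∧
    ∃ z, connectedComponentIn Dᶜ z = C ∧ p ∈ impression φ D Ω z}
  have hN : N.Countable := by
    refine h𝒞.biUnion fun C _ => Set.Subsingleton.countable ?_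
    rintro p ⟨hp, z, rfl, hpz⟩ p' ⟨hp', z', hzz, hpz'⟩
    rw [impression_congr hzz, h.impression_eq hpz, hp.2] at hpz'
    exact hpz'.symm
  have hmemN : ∀ p ∈ SingletonPart (frontier Ω), ∀ z ∈ Dᶜ, ∀ z' ∈ connectedComponentIn Dᶜ z,
      z' ≠ z → p ∈ impression φ D Ω z → p ∈ N := fun p hp z hz z' hz' hne hpz =>
    mem_iUnion₂.2 ⟨_, ⟨z, hz, rfl, nonempty_interior_of_isCircleDomain hD hz hz' hne⟩, hp, z, rfl,
      hpz⟩
  have hDc : frontier D ⊆ Dᶜ := by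
    rw [h.isOpen_left.frontier_eq]; exact fun x hx => hx.2
  set K : ℝ → Set ℂ := fun r => Prod.snd '' (graphClosure φ D ∩ Prod.fst ⁻¹' sphere z₀ r)
  have hK : ∀ r, IsCompact (K r) := fun r => (h.isCompact_graphClosure.inter_right
    (isClosed_sphere.preimage continuous_fst)).image continuous_snd
  have hhit : ∀ r, sphereImpression φ D Ω z₀ r ∩ SingletonPart (frontier Ω) ⊆
      K r ∩ SingletonPart (frontier Ω) ∪ N := by
    rintro r p ⟨⟨z, hz, hzD, -, hpz⟩, hp⟩
    obtain ⟨q, p', hq, hqz, hqp, hpp⟩ := id hpz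
    by_cases hqz' : q = z
    · subst hqz'
      have : p' = p := by
        have := mem_connectedComponentIn (h.frontier_of_graph hqp hq)
        rwa [connectedComponentIn_eq hpp, hp.2] at this
      exact Or.inl ⟨⟨(q, p), ⟨this ▸ hqp, hz⟩, rfl⟩, hp⟩
    · exact Or.inr (hmemN p hp z hzD q hqz hqz' hpz)
  have hKK : ∀ r r', r ≠ r' → K r ∩ K r' ∩ SingletonPart (frontier Ω) ⊆ N := by
    rintro r r' hrr p ⟨⟨⟨⟨z, _⟩, ⟨hzp, hz⟩, rfl⟩, ⟨⟨z', _⟩, ⟨hzp', hz'⟩, rfl⟩⟩, hp⟩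
    have hzz : z' ≠ z := by
      rintro rfl
      exact hrr (by rw [← mem_sphere.1 hz, ← mem_sphere.1 hz'])
    have hfz := h.symm.frontier_of_graph (h.graph_symm hzp) hp.1
    have hfz' := h.symm.frontier_of_graph (h.graph_symm hzp') hp.1
    have hpΩ : _ ∈ Ωᶜ := (h.isOpen_right.frontier_eq ▸ hp.1 : _ ∈ closure Ω \ Ω).2
    refine hmemN _ hp z (hDc hfz) z' ?_ hzz ⟨z, _, hfz, mem_connectedComponentIn (hDc hfz), hzp,
      mem_connectedComponentIn hp.1⟩
    exact connectedComponentIn_mono _ hDc (h.mem_component_left hfz hfz' hzp hzp'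
      (mem_connectedComponentIn hpΩ))
  have hnull : NullSingletonClass (μH[1] : Measure ℂ) :=
    Measure.nullSingletonClass_hausdorff ℂ one_pos
  have hN0 : μH[1] N = 0 := hN.measure_zero _
  obtain ⟨f, hf, hfin⟩ := hsing
  refine ⟨⋃ n, {r | 0 < (μH[1] : Measure ℂ).restrict (f n) (K r)}, countable_iUnion fun n => ?_,
    fun r hr π hπ => hπ.volume_image_eq_zero ?_⟩
  · have : IsFiniteMeasure ((μH[1] : Measure ℂ).restrict (f n)) := ⟨by
      rw [Measure.restrict_apply_univ]; exact hfin n⟩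
    refine Measure.countable_meas_pos_of_disjoint_iUnion₀
      (fun r => (hK r).measurableSet.nullMeasurableSet) fun r r' hrr => ?_
    change (μH[1] : Measure ℂ).restrict (f n) (K r ∩ K r') = 0
    rw [Measure.restrict_apply ((hK r).measurableSet.inter (hK r').measurableSet)]
    refine measure_mono_null (subset_trans (inter_subset_inter_right _ ?_) (hKK r r' hrr)) hN0
    rw [← hf]; exact subset_iUnion f n
  · refine measure_mono_null (hhit r) (measure_union_null ?_ hN0)
    rw [← hf, inter_iUnion, measure_iUnion_null_iff]
    intro n
    rw [← Measure.restrict_apply (hK r).measurableSet]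
    simp only [mem_iUnion, not_exists, mem_ofPred_eq, not_lt, nonpos_iff_eq_zero] at hr
    exact hr n

end ConfPair

theorem lintegral_inv_Ioo_eq_top {δ : ℝ} (hδ : 0 < δ) :
    ∫⁻ r in Ioo 0 δ, ENNReal.ofReal r⁻¹ = ⊤ := by
  by_contra hcon
  have h1 : IntervalIntegrable (fun x : ℝ => x⁻¹) volume 0 δ := by
    rw [intervalIntegrable_iff_integrableOn_Ioo_of_le hδ.le]
    refine (lintegral_ofReal_ne_top_iff_integrable measurable_inv.aestronglyMeasurable ?_).1 hcon
    refine (ae_restrict_mem measurableSet_Ioo).mono fun x hx => inv_nonneg.2 hx.1.le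
  rw [intervalIntegrable_inv_iff] at h1
  rcases h1 with h1 | h1
  · exact hδ.ne h1
  · exact h1 left_mem_uIcc

theorem lintegral_deriv_sq_eq_volume_image {f : ℂ → ℂ} {D : Set ℂ} (hD : IsOpen D)
    (hf : DifferentiableOn ℂ f D) (hinj : InjOn f D) :
    ∫⁻ z in D, ‖deriv f z‖ₑ ^ 2 = volume (f '' D) := by
  rw [← lintegral_abs_det_fderiv_eq_addHaar_image volume hD.measurableSet
    (f' := fun z => (ContinuousLinearMap.toSpanSingleton ℂ (deriv f z)).restrictScalars ℝ)
    (fun z hz => ?_) hinj]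
  · refine lintegral_congr fun z => ?_
    have : ((ContinuousLinearMap.toSpanSingleton ℂ (deriv f z)).restrictScalars ℝ).det =
        ‖deriv f z‖ ^ 2 := by
      rw [← Complex.normSq_eq_norm_sq, ← Algebra.norm_complex_apply, Algebra.norm_apply]
      refine congrArg LinearMap.det (LinearMap.ext fun w => ?_)
      simp [mul_comm]
    rw [this, abs_of_nonneg (sq_nonneg _), ENNReal.ofReal_pow (norm_nonneg _), ofReal_norm]
  · exact ((hf.differentiableAt (hD.mem_nhds hz)).hasDerivAt.hasFDerivAt.restrictScalars
      ℝ).hasFDerivWithinAt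

/-- Integration in polar coordinates centred at `z₀`. -/
theorem lintegral_polar {g : ℂ → ENNReal} (hg : Measurable g) (z₀ : ℂ) :
    ∫⁻ r in Ioi (0 : ℝ), ENNReal.ofReal r * ∫⁻ θ in Ioo (-Real.pi) Real.pi, g (circleMap z₀ r θ) =
      ∫⁻ z, g z := by
  have hcm : Measurable fun p : ℝ × ℝ => circleMap z₀ p.1 p.2 := by
    unfold circleMap; fun_prop
  rw [← lintegral_add_left_eq_self g z₀,
    ← Complex.lintegral_comp_polarCoord_symm fun z => g (z₀ + z), polarCoord_target,
    Measure.volume_eq_prod, ← Measure.prod_restrict, lintegral_prod]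
  · refine lintegral_congr fun r => ?_
    have hgr : Measurable fun θ => g (circleMap z₀ r θ) := hg.comp (hcm.comp measurable_prodMk_left)
    rw [← lintegral_const_mul _ hgr]
    refine lintegral_congr fun θ => ?_
    rw [Complex.polarCoord_symm_apply, smul_eq_mul, circleMap, Complex.exp_mul_I,
      Complex.ofReal_cos, Complex.ofReal_sin]
  · refine Measurable.aemeasurable ?_
    have : (fun p : ℝ × ℝ => ENNReal.ofReal p.1 • g (z₀ + Complex.polarCoord.symm p)) =
        fun p => ENNReal.ofReal p.1 * g (circleMap z₀ p.1 p.2) := by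
      funext p
      rw [Complex.polarCoord_symm_apply, smul_eq_mul, circleMap, Complex.exp_mul_I,
        Complex.ofReal_cos, Complex.ofReal_sin]
    rw [this]
    exact (measurable_fst.ennreal_ofReal).mul (hg.comp hcm)

theorem volume_image_sphere_le {f : ℂ → ℂ} {D : Set ℂ} (hD : IsOpen D)
    (hf : DifferentiableOn ℂ f D) (z₀ : ℂ) {r : ℝ} (hr : 0 < r) {π : ℂ →L[ℝ] ℝ} (hπ : ‖π‖ ≤ 1) :
    volume (π '' (f '' (D ∩ sphere z₀ r))) ≤
      ∫⁻ θ in Ioo (-Real.pi) Real.pi,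
        ENNReal.ofReal r * D.indicator (fun z => ‖deriv f z‖ₑ) (circleMap z₀ r θ) := by
  set s : Set ℝ := Ioc (-Real.pi) Real.pi ∩ circleMap z₀ r ⁻¹' D
  have hs : MeasurableSet s :=
    measurableSet_Ioc.inter (hD.preimage (continuous_circleMap z₀ r)).measurableSet
  set F : ℝ → ℝ := fun θ => π (f (circleMap z₀ r θ))
  have hF : ∀ θ ∈ s, HasDerivAt F (π (deriv f (circleMap z₀ r θ) * (circleMap 0 r θ * Complex.I)))
      θ := by
    intro θ hθ
    have h1 := (hf.differentiableAt (hD.mem_nhds hθ.2)).hasDerivAt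
    have h2 := h1.comp_of_eq θ (hasDerivAt_circleMap z₀ r θ) rfl
    exact π.hasFDerivAt.comp_hasDerivAt θ h2
  have hsub : π '' (f '' (D ∩ sphere z₀ r)) ⊆ F '' s := by
    rintro _ ⟨_, ⟨z, ⟨hzD, hz⟩, rfl⟩, rfl⟩
    have hz' : circleMap z₀ r (z - z₀).arg = z := by
      rw [circleMap, ← mem_sphere.1 hz, dist_eq_norm, Complex.norm_mul_exp_arg_mul_I]
      ring
    refine ⟨(z - z₀).arg, ⟨⟨Complex.neg_pi_lt_arg _, Complex.arg_le_pi _⟩, ?_⟩, ?_⟩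
    · rw [mem_preimage, hz']; exact hzD
    · simp only [F, hz']
  calc volume (π '' (f '' (D ∩ sphere z₀ r))) ≤ volume (F '' s) := measure_mono hsub
    _ ≤ ∫⁻ θ in s, ENNReal.ofReal |(ContinuousLinearMap.toSpanSingleton ℝ
          (π (deriv f (circleMap z₀ r θ) * (circleMap 0 r θ * Complex.I)))).det| :=
        addHaar_image_le_lintegral_abs_det_fderiv volume hs
          fun θ hθ => (hF θ hθ).hasFDerivAt.hasFDerivWithinAt
    _ ≤ ∫⁻ θ in s,
        ENNReal.ofReal r * D.indicator (fun z => ‖deriv f z‖ₑ) (circleMap z₀ r θ) := by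
        refine setLIntegral_mono' hs fun θ hθ => ?_
        rw [ContinuousLinearMap.det_toSpanSingleton, indicator_of_mem (mem_preimage.1 hθ.2), ← Real.norm_eq_abs,
          ofReal_norm, ← ofReal_norm, ← ofReal_norm, ← ENNReal.ofReal_mul hr.le]
        refine ENNReal.ofReal_le_ofReal ((π.le_of_opNorm_le hπ _).trans_eq ?_)
        rw [norm_mul, norm_mul, norm_circleMap_zero, Complex.norm_I, abs_of_pos hr]
        ring
    _ ≤ ∫⁻ θ in Ioc (-Real.pi) Real.pi,
        ENNReal.ofReal r * D.indicator (fun z => ‖deriv f z‖ₑ) (circleMap z₀ r θ) :=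
        lintegral_mono_set inter_subset_left
    _ = _ := by rw [restrict_Ioo_eq_restrict_Ioc]

theorem le_add_inv_mul_sq {κ : ENNReal} (hκ : κ ≠ 0) (hκ' : κ ≠ ⊤) (t : ENNReal) :
    t ≤ κ + κ⁻¹ * t ^ 2 := by
  rcases le_total t κ with h | h
  · exact h.trans le_self_add
  · calc t = κ⁻¹ * κ * t := by rw [ENNReal.inv_mul_cancel hκ hκ', one_mul]
      _ ≤ κ⁻¹ * t * t := by gcongr
      _ = κ⁻¹ * t ^ 2 := by ring
      _ ≤ _ := le_add_self

/-- The length–area argument: the images of small circles are short for many radii. -/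
theorem not_countable_short_radii {f : ℂ → ℂ} {D : Set ℂ} (hD : IsOpen D)
    (hf : DifferentiableOn ℂ f D) (hinj : InjOn f D) (hfin : volume (f '' D) ≠ ⊤) (z₀ : ℂ)
    {ε δ : ℝ} (hε : 0 < ε) (hδ : 0 < δ) :
    ¬ {r | r ∈ Ioo 0 δ ∧ ∀ π : ℂ →L[ℝ] ℝ, ‖π‖ ≤ 1 →
      volume (π '' (f '' (D ∩ sphere z₀ r))) ≤ ENNReal.ofReal ε}.Countable := by
  intro hcount
  set G : ℂ → ENNReal := D.indicator fun z => ‖deriv f z‖ₑ ^ 2 with hG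
  set g : ℂ → ENNReal := D.indicator fun z => ‖deriv f z‖ₑ with hg
  have hgG : ∀ z, g z ^ 2 = G z := by
    intro z
    by_cases hz : z ∈ D <;> simp [hg, hG, hz]
  have hgm : Measurable g := (measurable_deriv f).enorm.indicator hD.measurableSet
  have hGm : Measurable G := by
    rw [show G = fun z => g z ^ 2 from funext fun z => (hgG z).symm]
    exact hgm.pow_const 2
  have hcm : ∀ r, Measurable fun θ : ℝ => circleMap z₀ r θ := fun r =>
    (continuous_circleMap z₀ r).measurable
  have hA : ∫⁻ r in Ioi (0 : ℝ), ENNReal.ofReal r *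
      ∫⁻ θ in Ioo (-Real.pi) Real.pi, G (circleMap z₀ r θ) ≠ ⊤ := by
    rw [lintegral_polar hGm, lintegral_indicator hD.measurableSet,
      lintegral_deriv_sq_eq_volume_image hD hf hinj]
    exact hfin
  have hpi : 0 < Real.pi := Real.pi_pos
  set κ : ℝ := ε / (4 * Real.pi)
  have hκ : 0 < κ := by positivity
  have hκ0 : ENNReal.ofReal κ ≠ 0 := (ENNReal.ofReal_pos.2 hκ).ne'
  set a : ℝ → ENNReal := fun r => ∫⁻ θ in Ioo (-Real.pi) Real.pi, G (circleMap z₀ r θ) with ha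
  have hlen : ∀ r, 0 < r → ∫⁻ θ in Ioo (-Real.pi) Real.pi,
      ENNReal.ofReal r * g (circleMap z₀ r θ) ≤
      ENNReal.ofReal (ε / 2) + (ENNReal.ofReal κ)⁻¹ * (ENNReal.ofReal r ^ 2 * a r) := by
    intro r hr
    have hGr : Measurable fun θ => G (circleMap z₀ r θ) := hGm.comp (hcm r)
    calc ∫⁻ θ in Ioo (-Real.pi) Real.pi, ENNReal.ofReal r * g (circleMap z₀ r θ)
        ≤ ∫⁻ θ in Ioo (-Real.pi) Real.pi, (ENNReal.ofReal κ + (ENNReal.ofReal κ)⁻¹ *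
            (ENNReal.ofReal r ^ 2 * G (circleMap z₀ r θ))) := by
          refine lintegral_mono fun θ => ?_
          rw [← hgG, ← mul_pow]
          exact le_add_inv_mul_sq hκ0 ENNReal.ofReal_ne_top _
      _ = _ := by
          rw [lintegral_add_left measurable_const, lintegral_const_mul,
            lintegral_const_mul _ hGr, setLIntegral_const, Real.volume_Ioo,
            ← ENNReal.ofReal_mul hκ.le]
          · congr 2
            simp only [κ]; field_simp; ring
          · exact hGr.const_mul _
  have hlow : ∀ᵐ r ∂volume.restrict (Ioo (0 : ℝ) δ),
      ENNReal.ofReal (κ * (ε / 2)) * ENNReal.ofReal r⁻¹ ≤ ENNReal.ofReal r * a r := by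
    rw [ae_restrict_iff' measurableSet_Ioo]
    filter_upwards [hcount.ae_notMem volume] with r hr hrδ
    have hr0 := hrδ.1
    have : ∃ π : ℂ →L[ℝ] ℝ, ‖π‖ ≤ 1 ∧
        ENNReal.ofReal ε < volume (π '' (f '' (D ∩ sphere z₀ r))) := by
      by_contra! hcon
      exact hr ⟨hrδ, hcon⟩
    obtain ⟨π, hπ, hπε⟩ := this
    have h1 := (hπε.trans_le (volume_image_sphere_le hD hf z₀ hr0 hπ)).le.trans (hlen r hr0)
    have h2 : ENNReal.ofReal (ε / 2) ≤ (ENNReal.ofReal κ)⁻¹ * (ENNReal.ofReal r ^ 2 * a r) := by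
      rw [show ε = ε / 2 + ε / 2 by ring, ENNReal.ofReal_add (by positivity) (by positivity)] at h1
      simp only [add_halves] at h1
      exact (ENNReal.add_le_add_iff_left ENNReal.ofReal_ne_top).1 h1
    calc ENNReal.ofReal (κ * (ε / 2)) * ENNReal.ofReal r⁻¹
        = ENNReal.ofReal r⁻¹ * (ENNReal.ofReal κ * ENNReal.ofReal (ε / 2)) := by
          rw [ENNReal.ofReal_mul hκ.le, mul_comm]
      _ ≤ ENNReal.ofReal r⁻¹ * (ENNReal.ofReal κ *
          ((ENNReal.ofReal κ)⁻¹ * (ENNReal.ofReal r ^ 2 * a r))) := by gcongr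
      _ = (ENNReal.ofReal κ * (ENNReal.ofReal κ)⁻¹) * ((ENNReal.ofReal r⁻¹ * ENNReal.ofReal r) *
          (ENNReal.ofReal r * a r)) := by ring
      _ = ENNReal.ofReal r * a r := by
          rw [ENNReal.mul_inv_cancel hκ0 ENNReal.ofReal_ne_top,
            ← ENNReal.ofReal_mul (inv_nonneg.2 hr0.le), inv_mul_cancel₀ hr0.ne',
            ENNReal.ofReal_one, one_mul, one_mul]
  refine hA (top_le_iff.1 ?_)
  calc (⊤ : ENNReal) = ENNReal.ofReal (κ * (ε / 2)) * ∫⁻ r in Ioo 0 δ, ENNReal.ofReal r⁻¹ := by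
        rw [lintegral_inv_Ioo_eq_top hδ, ENNReal.mul_top]
        exact (ENNReal.ofReal_pos.2 (by positivity)).ne'
    _ = ∫⁻ r in Ioo 0 δ, ENNReal.ofReal (κ * (ε / 2)) * ENNReal.ofReal r⁻¹ :=
        (lintegral_const_mul _ measurable_inv.ennreal_ofReal).symm
    _ ≤ ∫⁻ r in Ioo 0 δ, ENNReal.ofReal r * a r := lintegral_mono_ae hlow
    _ ≤ _ := lintegral_mono_set Ioo_subset_Ioi_self

namespace ConfPair

variable {φ ψ : ℂ → ℂ} {D Ω : Set ℂ}

/-- The oscillation of `φ` on a circle is controlled by the projections of the image of the circle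
and of the impressions that it meets. -/
theorem oscDiam_le (h : ConfPair φ ψ D Ω) (hD : IsCircleDomain D) {z₀ : ℂ} (hz₀ : z₀ ∈ Dᶜ) {r : ℝ}
    (hr : 0 < r) {ε₁ ε₂ : ℝ} (hε₁ : 0 ≤ ε₁) (hε₂ : 0 ≤ ε₂)
    (h₁ : ∀ π : ℂ →L[ℝ] ℝ, ‖π‖ ≤ 1 →
      volume (π '' (φ '' (D ∩ sphere z₀ r))) ≤ ENNReal.ofReal ε₁)
    (h₂ : ∀ π : ℂ → ℝ, LipschitzWith 1 π →
      volume (π '' (sphereImpression φ D Ω z₀ r)) ≤ ENNReal.ofReal ε₂) :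
    oscDiam φ D z₀ r ≤ ε₁ + ε₂ := by
  refine diam_le_of_forall_dist_le (add_nonneg hε₁ hε₂) ?_
  rintro _ ⟨x, hx, rfl⟩ _ ⟨y, hy, rfl⟩
  obtain ⟨π, hπ, hπe⟩ := exists_dual_vector'' ℝ (φ y - φ x)
  have hπL : LipschitzWith 1 π := π.lipschitz.weaken (by exact_mod_cast hπ)
  have hG : ∀ z, z ∈ D ∩ sphere z₀ r → z ∈ (sphere z₀ r \ connectedComponentIn Dᶜ z₀) ∩ D :=
    fun z hz => ⟨⟨hz.2, fun hh => connectedComponentIn_subset _ _ hh hz.1⟩, hz.1⟩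
  have hsub : Ioo (π (φ x)) (π (φ y)) ⊆
      π '' (φ '' (D ∩ sphere z₀ r)) ∪ π '' (sphereImpression φ D Ω z₀ r) := by
    rintro c ⟨hxc, hcy⟩
    obtain ⟨z, hz, ⟨hzD, hzc⟩ | ⟨hzD, w, hw, hwc⟩⟩ := h.exists_crossing π.continuous
      (isPreconnected_sphere_diff hD hz₀ hr) (hG x hx) (hG y hy) hxc hcy
    · exact Or.inl ⟨φ z, ⟨z, ⟨hzD, hz.1⟩, rfl⟩, hzc⟩
    · exact Or.inr ⟨w, ⟨z, hz.1, hzD, hz.2, hw⟩, hwc⟩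
  have hvol := (measure_mono hsub).trans ((measure_union_le (μ := volume) _ _).trans
    (add_le_add (h₁ π hπ) (h₂ π hπL)))
  rw [Real.volume_Ioo, ← map_sub, hπe, ← ENNReal.ofReal_add hε₁ hε₂,
    ENNReal.ofReal_le_ofReal_iff (add_nonneg hε₁ hε₂)] at hvol
  rw [dist_comm, dist_eq_norm]
  exact hvol

theorem frequently_oscDiam_le (h : ConfPair φ ψ D Ω) (hD : IsCircleDomain D) {z₀ : ℂ}
    (hz₀ : z₀ ∈ frontier D) (hcount : (NondegComponents (frontier Ω)).Countable)
    (hsing : SigmaFiniteH1 (SingletonPart (frontier Ω))) {U : Set ℂ} (hU : IsOpen U)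
    (hQU : boundaryComp φ D (connectedComponentIn (frontier D) z₀) ⊆ U)
    (hsum : ∑' Q' : {Q' : Set ℂ // Q' ∈ NondegComponents (frontier Ω) ∧ Q' ⊆ U},
      ediam (Q' : Set ℂ) < ⊤) {ε : ℝ} (hε : 0 < ε) :
    ∃ᶠ r in 𝓝[>] (0 : ℝ), oscDiam φ D z₀ r ≤ ε := by
  intro hcon
  have hz₀D : z₀ ∈ Dᶜ := (h.isOpen_left.frontier_eq ▸ hz₀ : z₀ ∈ closure D \ D).2
  have hev := h.eventually_volume_image_le hz₀ hcount hU hQU hsum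
    (ENNReal.ofReal_pos.2 (half_pos hε))
  obtain ⟨δ, hδ, hsub⟩ := mem_nhdsGT_iff_exists_Ioo_subset.1 (hev.and hcon)
  obtain ⟨B, hB, hB0⟩ := h.exists_countable_volume_image_eq_zero hD z₀ hsing
  have hfin : volume (φ '' D) ≠ ⊤ := by
    refine (h.bdd_right.subset ?_).measure_lt_top.ne
    rintro _ ⟨z, hz, rfl⟩
    exact h.maps_left hz
  obtain ⟨r, ⟨hrδ, hr1⟩, hrB⟩ : ∃ r, (r ∈ Ioo 0 δ ∧ ∀ π : ℂ →L[ℝ] ℝ, ‖π‖ ≤ 1 →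
      volume (π '' (φ '' (D ∩ sphere z₀ r))) ≤ ENNReal.ofReal (ε / 2)) ∧ r ∉ B := by
    by_contra! hall
    exact not_countable_short_radii h.isOpen_left h.diff_left h.injOn hfin z₀ (half_pos hε) hδ
      (hB.mono hall)
  obtain ⟨hr2, hr3⟩ := hsub hrδ
  refine hr3 ((h.oscDiam_le hD hz₀D hrδ.1 (half_pos hε).le (half_pos hε).le hr1
    fun π hπ => ?_).trans_eq (add_halves ε))
  rw [← sdiff_union_inter (sphereImpression φ D Ω z₀ r) (SingletonPart (frontier Ω)), image_union]
  refine (measure_union_le _ _).trans ?_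
  rw [hB0 r hrB π hπ, add_zero]
  exact hr2 π hπ

end ConfPair

theorem oscLiminfZero_of_frequently {φ : ℂ → ℂ} {D Ω : Set ℂ} (hΩ : Bornology.IsBounded Ω)
    (hφ : MapsTo φ D Ω) {z₀ : ℂ}
    (h : ∀ ε > 0, ∃ᶠ r in 𝓝[>] (0 : ℝ), oscDiam φ D z₀ r ≤ ε) : OscLiminfZero φ D z₀ := by
  have h0 : ∀ r, 0 ≤ oscDiam φ D z₀ r := fun _ => diam_nonneg
  have h1 : ∀ r, oscDiam φ D z₀ r ≤ diam Ω := fun r =>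
    diam_mono ((image_mono inter_subset_left).trans hφ.image_subset) hΩ
  have hlow : IsBoundedUnder (· ≥ ·) (𝓝[>] (0 : ℝ)) (oscDiam φ D z₀) :=
    isBoundedUnder_of ⟨0, h0⟩
  have hup : IsBoundedUnder (· ≤ ·) (𝓝[>] (0 : ℝ)) (oscDiam φ D z₀) :=
    isBoundedUnder_of ⟨_, h1⟩
  refine le_antisymm (le_of_forall_pos_le_add fun ε hε => ?_) ?_
  · rw [zero_add]
    exact liminf_le_of_frequently_le (h ε hε) hlow
  · exact le_liminf_of_le hup.isCoboundedUnder_ge (Eventually.of_forall h0)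

/-- Oscillation estimate for a conformal map of a circle domain, first approach. -/
theorem stmt_14 (D Ω : Set ℂ) (φ : ℂ → ℂ)
    (hD : IsCircleDomain D)
    (hΩ : IsPlanarDomain Ω) (hΩb : Bornology.IsBounded Ω)
    (hφ : IsConformalHomeoOnto φ D Ω)
    (hcount : (NondegComponents (frontier Ω)).Countable)
    (hsing : SigmaFiniteH1 (SingletonPart (frontier Ω)))
    (P : Set ℂ) (hP : P ∈ NondegComponents (frontier Ω))
    (Q : Set ℂ) (hQ : ∃ x ∈ frontier D, Q = connectedComponentIn (frontier D) x)
    (hQP : boundaryComp φ D Q = P)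
    (U : Set ℂ) (hUopen : IsOpen U) (hPU : P ⊆ U)
    (hsum : ∑' Q' : {Q' : Set ℂ // Q' ∈ NondegComponents (frontier Ω) ∧ Q' ⊆ U},
              EMetric.diam (Q' : Set ℂ) < ⊤) :
    ∀ z₀ ∈ Q, OscLiminfZero φ D z₀ := by
  obtain ⟨ψ, h⟩ := exists_confPair hD.1 hD.2.1 hΩ hΩb hφ
  obtain ⟨x, -, rfl⟩ := hQ
  intro z₀ hz₀
  rw [connectedComponentIn_eq hz₀] at hQP
  refine oscLiminfZero_of_frequently hΩb h.maps_left fun ε hε => ?_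
  exact h.frequently_oscDiam_le hD (connectedComponentIn_subset _ _ hz₀) hcount hsing hUopen
    (hQP ▸ hPU) hsum hε
end
end

section
/- Let D ⊆ ℂ be a domain, let R > 0, and let φ : D → ℂ be an injective holomorphic map with |φ(z)| < R for all z ∈ D. Fix z₀ ∈ ℂ and for r > 0 set Λ_r(z₀) = r · ∫_{{θ ∈ [0,2π) : z₀ + r e^{iθ} ∈ D}} |φ′(z₀ + r e^{iθ})| dθ (the arc length of φ(C_r(z₀) ∩ D)). Then for every ε > 0 and every ρ ∈ (0,1) there exists N such that for all n > N the interval [ρ^{2^{n+1}}, ρ^{2^n}] contains a Lebesgue measurable subset E_n of positive Lebesgue measure with sup_{r ∈ E_n} Λ_r(z₀) < ε/4. -/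
open Set Metric Filter MeasureTheory Topology

noncomputable section

/-- The arc length `Λ_r(z₀)` of `φ(C_r(z₀) ∩ D)`. -/
def arcLen (φ : ℂ → ℂ) (D : Set ℂ) (z₀ : ℂ) (r : ℝ) : ℝ :=
  r * ∫ θ in {θ : ℝ | θ ∈ Set.Ico (0:ℝ) (2 * Real.pi) ∧
        z₀ + (r : ℂ) * Complex.exp ((θ : ℂ) * Complex.I) ∈ D},
      ‖deriv φ (z₀ + (r : ℂ) * Complex.exp ((θ : ℂ) * Complex.I))‖

/-- The area of the image of an injective holomorphic map. -/
theorem setLIntegral_enorm_deriv_sq_eq_volume_image {D : Set ℂ} (hD : IsOpen D) {φ : ℂ → ℂ}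
    (hφ : DifferentiableOn ℂ φ D) (hinj : Set.InjOn φ D) :
    ∫⁻ z in D, ‖deriv φ z‖ₑ ^ 2 = volume (φ '' D) := by
  rw [← lintegral_abs_det_fderiv_eq_addHaar_image volume hD.measurableSet
    (f' := fun z ↦ (fderiv ℂ φ z).restrictScalars ℝ) (fun z hz ↦
      ((hφ.differentiableAt (hD.mem_nhds hz)).hasFDerivAt.restrictScalars ℝ).hasFDerivWithinAt)
    hinj]
  refine lintegral_congr fun z ↦ ?_
  rw [← ofReal_norm, ← ENNReal.ofReal_pow (norm_nonneg _)]
  simp [ContinuousLinearMap.det, LinearMap.det_restrictScalars, Algebra.norm_complex_eq,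
    Complex.normSq_eq_norm_sq]

/-- Integration in polar coordinates about an arbitrary centre, with angles in `[0, 2π)`. -/
theorem lintegral_eq_lintegral_polar {f : ℂ → ENNReal} (hf : Measurable f) (z₀ : ℂ) :
    ∫⁻ r in Ioi (0 : ℝ), ENNReal.ofReal r *
      ∫⁻ θ in Ico (0 : ℝ) (2 * Real.pi), f (z₀ + (r : ℂ) * Complex.exp ((θ : ℂ) * Complex.I)) =
    ∫⁻ z, f z := by
  have hshift (r : ℝ) :
      ∫⁻ θ in Ico (0 : ℝ) (2 * Real.pi), f (z₀ + (r : ℂ) * Complex.exp ((θ : ℂ) * Complex.I)) =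
      ∫⁻ θ in Ioo (-Real.pi) Real.pi, f (z₀ - Complex.polarCoord.symm (r, θ)) := by
    rw [restrict_Ioo_eq_restrict_Ico,
      ← (measurePreserving_add_right volume Real.pi).setLIntegral_comp_preimage_emb
        (measurableEmbedding_addRight Real.pi)]
    have : (fun x : ℝ ↦ x + Real.pi) ⁻¹' Ico 0 (2 * Real.pi) = Ico (-Real.pi) Real.pi := by
      ext x
      simp only [mem_preimage, mem_Ico]
      constructor <;> rintro ⟨h, h'⟩ <;> constructor <;> linarith
    rw [this]
    refine lintegral_congr fun θ ↦ ?_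
    congr 1
    rw [Complex.polarCoord_symm_apply, Complex.ofReal_add, add_mul, Complex.exp_add,
      Complex.exp_pi_mul_I, Complex.exp_mul_I]
    push_cast
    ring
  have hmeas : Measurable fun p : ℝ × ℝ ↦
      ENNReal.ofReal p.1 * f (z₀ - Complex.polarCoord.symm p) := by
    simp only [Complex.polarCoord_symm_apply]
    fun_prop
  rw [← lintegral_sub_left_eq_self f z₀, ← Complex.lintegral_comp_polarCoord_symm,
    polarCoord_target, Measure.volume_eq_prod]
  simp only [smul_eq_mul]
  rw [setLIntegral_prod _ hmeas.aemeasurable]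
  refine lintegral_congr fun r ↦ ?_
  rw [hshift, ← lintegral_const_mul]
  simp only [Complex.polarCoord_symm_apply]
  fun_prop

/-- If the logarithmic integral of `r² A(r)` is small compared to `δ log (b / a)`, then
`r² A(r) < δ` on a subset of `[a, b]` of positive measure. -/
theorem volume_setOf_sq_mul_lt_pos {A : ℝ → ENNReal} {a b M δ : ℝ}
    (ha : 0 < a) (hab : a < b)
    (hM : ∫⁻ r in Ioi (0 : ℝ), ENNReal.ofReal r * A r ≤ ENNReal.ofReal M)
    (h0 : 0 ≤ M) (hδ : 0 < δ) (hlog : M < δ * Real.log (b / a)) :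
    0 < volume {r | r ∈ Icc a b ∧ ENNReal.ofReal r ^ 2 * A r < ENNReal.ofReal δ} := by
  rw [pos_iff_ne_zero]
  intro hzero
  have hae : ∀ᵐ r ∂volume.restrict (Icc a b),
      ENNReal.ofReal (δ * r⁻¹) ≤ ENNReal.ofReal r * A r := by
    rw [ae_restrict_iff' measurableSet_Icc]
    filter_upwards [measure_eq_zero_iff_ae_notMem.1 hzero] with r hr hrI
    have hr0 : 0 < r := ha.trans_le hrI.1
    have hr' : ENNReal.ofReal δ ≤ ENNReal.ofReal r ^ 2 * A r := not_lt.1 fun h ↦ hr ⟨hrI, h⟩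
    calc ENNReal.ofReal (δ * r⁻¹) = ENNReal.ofReal r⁻¹ * ENNReal.ofReal δ := by
          rw [mul_comm, ENNReal.ofReal_mul (by positivity)]
      _ ≤ ENNReal.ofReal r⁻¹ * (ENNReal.ofReal r ^ 2 * A r) := by gcongr
      _ = ENNReal.ofReal r * A r := by
          rw [← mul_assoc, ← ENNReal.ofReal_pow hr0.le, ← ENNReal.ofReal_mul (by positivity)]
          congr 2
          field_simp
  have hint : IntegrableOn (fun r : ℝ ↦ δ * r⁻¹) (Icc a b) := by
    refine ContinuousOn.integrableOn_Icc (continuousOn_const.mul (continuousOn_inv₀.mono ?_))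
    intro r hr
    exact (ha.trans_le hr.1).ne'
  have hval : ∫ r in Icc a b, δ * r⁻¹ = δ * Real.log (b / a) := by
    rw [integral_Icc_eq_integral_Ioc, ← intervalIntegral.integral_of_le hab.le,
      intervalIntegral.integral_const_mul, integral_inv_of_pos ha (ha.trans hab)]
  have hnonneg : 0 ≤ᵐ[volume.restrict (Icc a b)] fun r : ℝ ↦ δ * r⁻¹ := by
    filter_upwards [ae_restrict_mem measurableSet_Icc] with r hr
    have : 0 < r := ha.trans_le hr.1
    show 0 ≤ δ * r⁻¹
    positivity
  have : ENNReal.ofReal (δ * Real.log (b / a)) ≤ ENNReal.ofReal M := by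
    rw [← hval, ofReal_integral_eq_lintegral_ofReal hint hnonneg]
    exact (lintegral_mono_ae hae).trans
      ((lintegral_mono_set fun r hr ↦ ha.trans_le hr.1).trans hM)
  exact hlog.not_ge ((ENNReal.ofReal_le_ofReal_iff h0).1 this)

theorem ENNReal.le_add_inv_mul_sq (x : ENNReal) {η : ENNReal} (h0 : η ≠ 0) (h : η ≠ ⊤) :
    x ≤ η + η⁻¹ * x ^ 2 := by
  rcases le_total x η with hx | hx
  · exact hx.trans le_self_add
  · refine le_trans ?_ le_add_self
    calc x = η⁻¹ * (η * x) := by rw [← mul_assoc, ENNReal.inv_mul_cancel h0 h, one_mul]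
      _ ≤ η⁻¹ * x ^ 2 := by rw [sq]; gcongr

/-- The angular integral over the circle of radius `r` of the density `|φ'|²` on `D`. -/
def angularEnergy (φ : ℂ → ℂ) (D : Set ℂ) (z₀ : ℂ) (r : ℝ) : ENNReal :=
  ∫⁻ θ in Ico (0 : ℝ) (2 * Real.pi), D.indicator (fun z ↦ ‖deriv φ z‖ₑ ^ 2)
    (z₀ + (r : ℂ) * Complex.exp ((θ : ℂ) * Complex.I))

theorem measurable_indicator_enorm_deriv_sq (φ : ℂ → ℂ) {D : Set ℂ} (hD : MeasurableSet D) :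
    Measurable (D.indicator fun z ↦ ‖deriv φ z‖ₑ ^ 2) :=
  ((measurable_deriv φ).enorm.pow_const 2).indicator hD

theorem measurable_angularEnergy (φ : ℂ → ℂ) {D : Set ℂ} (hD : MeasurableSet D) (z₀ : ℂ) :
    Measurable (angularEnergy φ D z₀) := by
  have := measurable_indicator_enorm_deriv_sq φ hD
  unfold angularEnergy
  refine Measurable.lintegral_prod_right' (f := fun p : ℝ × ℝ ↦
    D.indicator (fun z ↦ ‖deriv φ z‖ₑ ^ 2)
      (z₀ + (p.1 : ℂ) * Complex.exp ((p.2 : ℂ) * Complex.I))) ?_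
  fun_prop

theorem ofReal_arcLen_le (φ : ℂ → ℂ) {D : Set ℂ} (hD : MeasurableSet D) (z₀ : ℂ) {r η : ℝ}
    (hr : 0 < r) (hη : 0 < η) :
    ENNReal.ofReal (arcLen φ D z₀ r) ≤ ENNReal.ofReal (2 * Real.pi * η) +
      ENNReal.ofReal η⁻¹ * (ENNReal.ofReal r ^ 2 * angularEnergy φ D z₀ r) := by
  set p : ℝ → ℂ := fun θ ↦ z₀ + (r : ℂ) * Complex.exp ((θ : ℂ) * Complex.I) with hp
  have hpm : Measurable p := by fun_prop
  have hset : {θ : ℝ | θ ∈ Set.Ico (0:ℝ) (2 * Real.pi) ∧ p θ ∈ D} =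
      p ⁻¹' D ∩ Ico 0 (2 * Real.pi) := by
    ext θ
    exact and_comm
  have hg : Measurable (D.indicator fun z ↦ ‖deriv φ z‖ₑ) :=
    (measurable_deriv φ).enorm.indicator hD
  have hη0 : ENNReal.ofReal η ≠ 0 := (ENNReal.ofReal_pos.2 hη).ne'
  calc ENNReal.ofReal (arcLen φ D z₀ r)
      ≤ ENNReal.ofReal r * ∫⁻ θ in p ⁻¹' D ∩ Ico 0 (2 * Real.pi), ‖deriv φ (p θ)‖ₑ := by
        rw [arcLen, ENNReal.ofReal_mul hr.le, ← hset]
        gcongr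
        refine (Real.ofReal_le_enorm _).trans ((enorm_integral_le_lintegral_enorm _).trans ?_)
        simp [hp]
    _ = ∫⁻ θ in Ico 0 (2 * Real.pi),
          ENNReal.ofReal r * D.indicator (fun z ↦ ‖deriv φ z‖ₑ) (p θ) := by
        have hm : Measurable fun θ ↦ D.indicator (fun z ↦ ‖deriv φ z‖ₑ) (p θ) := hg.comp hpm
        rw [lintegral_const_mul _ hm, ← Measure.restrict_restrict (hpm hD),
          ← lintegral_indicator (hpm hD)]
        rfl
    _ ≤ ∫⁻ θ in Ico 0 (2 * Real.pi), (ENNReal.ofReal η + (ENNReal.ofReal η)⁻¹ *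
          (ENNReal.ofReal r ^ 2 * D.indicator (fun z ↦ ‖deriv φ z‖ₑ ^ 2) (p θ))) := by
        refine lintegral_mono fun θ ↦
          (ENNReal.le_add_inv_mul_sq _ hη0 ENNReal.ofReal_ne_top).trans_eq ?_
        rw [mul_pow]
        by_cases h : p θ ∈ D <;> simp [h]
    _ = _ := by
        have hm : Measurable fun θ ↦ D.indicator (fun z ↦ ‖deriv φ z‖ₑ ^ 2) (p θ) :=
          (measurable_indicator_enorm_deriv_sq φ hD).comp hpm
        rw [lintegral_add_left measurable_const, lintegral_const_mul _ (hm.const_mul _),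
          lintegral_const_mul _ hm, ENNReal.ofReal_inv_of_pos hη, setLIntegral_const,
          Real.volume_Ico, sub_zero, ← ENNReal.ofReal_mul hη.le, mul_comm η]
        rfl

/-- Generalized Wolff's lemma. -/
theorem stmt_15 (D : Set ℂ) (hD : IsPlanarDomain D) (R : ℝ) (hR : 0 < R)
    (φ : ℂ → ℂ) (hφ : DifferentiableOn ℂ φ D) (hinj : Set.InjOn φ D)
    (hbound : ∀ z ∈ D, ‖φ z‖ < R) (z₀ : ℂ) :
    ∀ ε > (0:ℝ), ∀ ρ ∈ Set.Ioo (0:ℝ) 1, ∃ N : ℕ, ∀ n > N,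
      ∃ E : Set ℝ, MeasurableSet E ∧ E ⊆ Set.Icc (ρ ^ (2 ^ (n + 1))) (ρ ^ (2 ^ n)) ∧
        0 < volume E ∧
        ∃ c < ε / 4, ∀ r ∈ E, arcLen φ D z₀ r ≤ c := by
  rintro ε hε ρ ⟨hρ0, hρ1⟩
  have hDo : IsOpen D := hD.2.1
  have hfin : volume (φ '' D) ≠ ⊤ := by
    refine ne_top_of_le_ne_top (measure_ball_lt_top (x := (0 : ℂ)) (r := R)).ne
      (measure_mono ?_)
    rintro _ ⟨z, hz, rfl⟩
    simpa using hbound z hz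
  set M : ℝ := (volume (φ '' D)).toReal with hMdef
  have hM : ∫⁻ r in Ioi (0 : ℝ), ENNReal.ofReal r * angularEnergy φ D z₀ r ≤
      ENNReal.ofReal M := by
    rw [hMdef, ENNReal.ofReal_toReal hfin,
      ← setLIntegral_enorm_deriv_sq_eq_volume_image hDo hφ hinj,
      ← lintegral_indicator hDo.measurableSet,
      ← lintegral_eq_lintegral_polar
        (measurable_indicator_enorm_deriv_sq φ hDo.measurableSet) z₀]
    rfl
  set η : ℝ := ε / (32 * Real.pi) with hη
  have hη0 : 0 < η := by positivity
  set δ : ℝ := η * (ε / 16) with hδ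
  have hδ0 : 0 < δ := by positivity
  have hl : 0 < δ * -Real.log ρ := mul_pos hδ0 (neg_pos.2 (Real.log_neg hρ0 hρ1))
  obtain ⟨N, hN⟩ := exists_nat_gt (M / (δ * -Real.log ρ))
  refine ⟨N, fun n hn ↦ ?_⟩
  have hpow : 0 < ρ ^ 2 ^ (n + 1) := by positivity
  have hlt : ρ ^ 2 ^ (n + 1) < ρ ^ 2 ^ n :=
    pow_lt_pow_right_of_lt_one₀ hρ0 hρ1 (Nat.pow_lt_pow_right one_lt_two n.lt_succ_self)
  have hlog : M < δ * Real.log (ρ ^ 2 ^ n / ρ ^ 2 ^ (n + 1)) := by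
    rw [Real.log_div (by positivity) (by positivity), Real.log_pow, Real.log_pow]
    have h1 : (N : ℝ) < 2 ^ n := by exact_mod_cast hn.trans n.lt_two_pow_self
    have h2 := (div_lt_iff₀ hl).1 (hN.trans h1)
    push_cast
    rw [pow_succ]
    linarith
  have hmeas : Measurable fun r : ℝ ↦ ENNReal.ofReal r ^ 2 * angularEnergy φ D z₀ r :=
    (ENNReal.measurable_ofReal.pow_const 2).mul
      (measurable_angularEnergy φ hDo.measurableSet z₀)
  refine ⟨{r | r ∈ Icc (ρ ^ 2 ^ (n + 1)) (ρ ^ 2 ^ n) ∧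
      ENNReal.ofReal r ^ 2 * angularEnergy φ D z₀ r < ENNReal.ofReal δ},
    measurableSet_Icc.inter (measurableSet_lt hmeas measurable_const), fun r hr ↦ hr.1,
    volume_setOf_sq_mul_lt_pos hpow hlt hM ENNReal.toReal_nonneg hδ0 hlog,
    ε / 8, by linarith, fun r hr ↦ ?_⟩
  have hr0 : 0 < r := hpow.trans_le hr.1.1
  refine (ENNReal.ofReal_le_ofReal_iff (by positivity)).1
    ((ofReal_arcLen_le φ hDo.measurableSet z₀ hr0 hη0).trans ?_)
  calc _ ≤ ENNReal.ofReal (2 * Real.pi * η) + ENNReal.ofReal η⁻¹ * ENNReal.ofReal δ := by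
        gcongr
        exact hr.2.le
    _ = ENNReal.ofReal (ε / 8) := by
        rw [← ENNReal.ofReal_mul (by positivity),
          ← ENNReal.ofReal_add (by positivity) (by positivity)]
        congr 1
        rw [hδ, inv_mul_cancel_left₀ hη0.ne', hη]
        field_simp
        norm_num
end
end

section
/- Let D ⊆ ℂ be a domain whose boundary ∂D has σ-finite linear measure, and let z₀ ∈ ∂D. Let R₀ be the set of all r > 0 such that the circle C_r(z₀) = {z ∈ ℂ : |z − z₀| = r} contains uncountably many points x with the property that the singleton {x} is a connected component of ∂D. Then R₀ has Lebesgue measure zero. -/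
open Set Metric Filter MeasureTheory Topology

noncomputable section

open scoped ENNReal in
/-- Covers of a set of finite linear measure by pieces of diameter at most `δ`. -/
theorem exists_cover_tsum_ediam_le {X : Type*} [EMetricSpace X] [MeasurableSpace X]
    [BorelSpace X] {A : Set X} (hA : μH[1] A < ⊤) {δ : ℝ≥0∞} (hδ : 0 < δ) :
    ∃ t : ℕ → Set X, A ⊆ ⋃ i, t i ∧ (∀ i, ediam (t i) ≤ δ) ∧
      ∑' i, ediam (t i) ≤ μH[1] A + 1 := by
  have hlt : μH[1] A < μH[1] A + 1 := ENNReal.lt_add_right hA.ne one_ne_zero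
  have hle := le_of_eq (Measure.hausdorffMeasure_apply 1 A).symm
  have h := ((le_iSup₂ (f := fun (r : ℝ≥0∞) (_ : 0 < r) => ⨅ (t : ℕ → Set X)
    (_ : A ⊆ ⋃ n, t n) (_ : ∀ n, ediam (t n) ≤ r),
      ∑' n, ⨆ _ : (t n).Nonempty, ediam (t n) ^ (1 : ℝ)) δ hδ).trans hle).trans_lt hlt
  simp only [iInf_lt_iff] at h
  obtain ⟨t, hAt, ht, hsum⟩ := h
  refine ⟨t, hAt, ht, le_trans (ENNReal.tsum_le_tsum fun i => ?_) hsum.le⟩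
  rcases (t i).eq_empty_or_nonempty with hi | hi
  · simp [hi]
  · simp [hi]

open scoped ENNReal in
/-- If the pieces of a cover have diameter less than the separation of a finite set `F` in a fibre
of `g`, then at least `#F` of the images of the pieces contain the base point of the fibre. -/
theorem card_le_tsum_indicator_image {X : Type*} [EMetricSpace X] {g : X → ℝ} {r : ℝ}
    {F : Finset X} {δ : ℝ≥0∞} (hF : ∀ x ∈ F, ∀ y ∈ F, x ≠ y → δ < edist x y)
    (hg : ∀ x ∈ F, g x = r) {t : ℕ → Set X} (hcov : ↑F ⊆ ⋃ i, t i)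
    (ht : ∀ i, ediam (t i) ≤ δ) :
    (F.card : ℝ≥0∞) ≤ ∑' i, (closure (g '' t i)).indicator 1 r := by
  classical
  have hmem : ∀ x ∈ F, ∃ i, x ∈ t i := fun x hx => mem_iUnion.1 (hcov hx)
  choose! i hi using hmem
  have hinj : Set.InjOn i F := by
    intro x hx y hy hxy
    by_contra hne
    exact (hF x hx y hy hne).not_ge
      ((Metric.edist_le_ediam_of_mem (hi x hx) (hxy ▸ hi y hy)).trans (ht _))
  calc (F.card : ℝ≥0∞) = ∑ j ∈ F.image i, 1 := by simp [Finset.card_image_of_injOn hinj]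
    _ ≤ ∑ j ∈ F.image i, (closure (g '' t j)).indicator 1 r := by
        refine Finset.sum_le_sum fun j hj => ?_
        obtain ⟨x, hx, rfl⟩ := Finset.mem_image.1 hj
        have hr : r ∈ closure (g '' t (i x)) := subset_closure ⟨x, hi x hx, hg x hx⟩
        simp [hr]
    _ ≤ _ := ENNReal.sum_le_tsum _

open scoped ENNReal in
/-- Qualitative Eilenberg inequality: almost every fibre of a 1-Lipschitz real function on a set
of finite linear measure is finite. -/
theorem ae_finite_fiber_of_hausdorffMeasure_lt_top {X : Type*} [EMetricSpace X]
    [MeasurableSpace X] [BorelSpace X] {g : X → ℝ} (hg : LipschitzWith 1 g) {A : Set X}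
    (hA : μH[1] A < ⊤) : ∀ᵐ r : ℝ, {x ∈ A | g x = r}.Finite := by
  have hpos : ∀ n : ℕ, (0 : ℝ≥0∞) < (n : ℝ≥0∞)⁻¹ := fun n => by simp
  choose t hAt ht hsum using fun n : ℕ => exists_cover_tsum_ediam_le hA (hpos n)
  let N : ℕ → ℝ → ℝ≥0∞ := fun n r => ∑' i, (closure (g '' t n i)).indicator 1 r
  have hind : ∀ n i, Measurable ((closure (g '' t n i)).indicator (1 : ℝ → ℝ≥0∞)) := fun n i =>
    measurable_one.indicator isClosed_closure.measurableSet
  have hN : ∀ n, Measurable (N n) := fun n => Measurable.tsum (hind n)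
  have hint : ∀ n, ∫⁻ r, N n r ≤ μH[1] A + 1 := by
    intro n
    rw [lintegral_tsum fun i => (hind n i).aemeasurable]
    refine (ENNReal.tsum_le_tsum fun i => ?_).trans (hsum n)
    rw [lintegral_indicator_one isClosed_closure.measurableSet]
    refine (Real.volume_le_diam _).trans ?_
    rw [Metric.ediam_closure]
    simpa using hg.ediam_image_le (t n i)
  have hfatou : ∫⁻ r, liminf (fun n => N n r) atTop ≠ ⊤ := by
    refine ne_top_of_le_ne_top (ENNReal.add_ne_top.2 ⟨hA.ne, ENNReal.one_ne_top⟩)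
      ((lintegral_liminf_le hN).trans ?_)
    exact liminf_le_of_le (by isBoundedDefault) fun b hb => by
      obtain ⟨n, hn⟩ := hb.exists
      exact hn.trans (hint n)
  filter_upwards [ae_lt_top (.liminf hN) hfatou] with r hr
  by_contra hinf
  obtain ⟨k, hk⟩ := ENNReal.exists_nat_gt hr.ne
  obtain ⟨F, hFs, hFk⟩ := Set.Infinite.exists_subset_card_eq hinf k
  refine hk.not_ge (le_liminf_of_le (by isBoundedDefault) ?_)
  have hsep : ∀ᶠ n : ℕ in atTop, ∀ x ∈ F, ∀ y ∈ F, x ≠ y → (n : ℝ≥0∞)⁻¹ < edist x y := by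
    simp only [Finset.eventually_all]
    refine fun x _ y _ => ?_
    by_cases hxy : x = y
    · simp [hxy]
    · filter_upwards [ENNReal.tendsto_inv_nat_nhds_zero.eventually_lt_const (edist_pos.2 hxy)]
        with n hn _ using hn
  filter_upwards [hsep] with n hn
  rw [← hFk]
  exact card_le_tsum_indicator_image hn (fun x hx => (hFs hx).2)
    (fun x hx => hAt n (hFs hx).1) (ht n)

/-- If `∂D` has σ-finite linear measure, then for almost every `r > 0` the circle
`C_r(z₀)` contains at most countably many singleton components of `∂D`. -/
theorem stmt_16 (D : Set ℂ) (hD : IsPlanarDomain D)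
    (hσ : SigmaFiniteH1 (frontier D)) (z₀ : ℂ) (hz₀ : z₀ ∈ frontier D) :
    volume {r : ℝ | 0 < r ∧
      ¬ Set.Countable {x | x ∈ Metric.sphere z₀ r ∧
          connectedComponentIn (frontier D) x = {x}}} = 0 := by
  obtain ⟨f, hf, hfin⟩ := hσ
  have hae : ∀ᵐ r : ℝ, ∀ n, {x ∈ f n | dist x z₀ = r}.Finite := ae_all_iff.2 fun n =>
    ae_finite_fiber_of_hausdorffMeasure_lt_top (LipschitzWith.dist_left z₀) (hfin n)
  refine measure_mono_null (fun r hr => ?_) (ae_iff.1 hae)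
  refine fun hr' => hr.2 ?_
  refine (countable_iUnion fun n => (hr' n).countable).mono ?_
  rintro x ⟨hxr, hx⟩
  have hxD : x ∈ frontier D := by
    rw [← connectedComponentIn_nonempty_iff, hx]
    exact singleton_nonempty x
  rw [← hf] at hxD
  obtain ⟨n, hn⟩ := mem_iUnion.1 hxD
  exact mem_iUnion.2 ⟨n, hn, hxr⟩
end
end
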